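/- Let d be a positive integer and let J ⊊ I be squarefree monomial ideals of S such that I is minimally generated by squarefree monomials f_1,…,f_r of degree d with r ≤ 3 together with a (possibly empty) set E of squarefree monomials of degrees ≥ d+1, and J is either 0 or generated by squarefree monomials of degrees ≥ d+1. If sdepth_S I/J = d+1, then depth_S I/J ≤ d+1. -/

import Mathlib

open MvPolynomial

/-- The squarefree monomial `∏_{i ∈ T} x_i` in `K[x_1,…,x_n]`. -/
noncomputable def sqm (K : Type*) [Field K] {n : ℕ} (T : Finset (Fin n)) :
    MvPolynomial (Fin n) K := ∏ i ∈ T, X i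

/-- The poset `P_{I \ J}` of (supports of) squarefree monomials of `I \ J`. -/
def sqPoset {K : Type*} [Field K] {n : ℕ} (I J : Ideal (MvPolynomial (Fin n) K)) :
    Set (Finset (Fin n)) :=
  {T | sqm K T ∈ I ∧ sqm K T ∉ J}

/-- The squarefree monomials of degree `k` in `I \ J`. -/
def degSet {K : Type*} [Field K] {n : ℕ} (I J : Ideal (MvPolynomial (Fin n) K)) (k : ℕ) :
    Set (Finset (Fin n)) :=
  {T ∈ sqPoset I J | T.card = k}

/-- A partition of `P_{I\J}` into intervals `[u,v]`, recorded as a finite set of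
pairs `(u, v)`: each monomial of `P_{I\J}` lies in exactly one interval. -/
def IsIntervalPartition {K : Type*} [Field K] {n : ℕ}
    (I J : Ideal (MvPolynomial (Fin n) K))
    (F : Finset (Finset (Fin n) × Finset (Fin n))) : Prop :=
  (∀ p ∈ F, p.1 ∈ sqPoset I J ∧ p.2 ∈ sqPoset I J ∧ p.1 ⊆ p.2) ∧
  (∀ T ∈ sqPoset I J, ∃! p, p ∈ F ∧ p.1 ⊆ T ∧ T ⊆ p.2)

/-- The Stanley depth of `I/J`: the maximum over interval partitions of the
minimal degree of an upper endpoint. -/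
noncomputable def sdepth {K : Type*} [Field K] {n : ℕ}
    (I J : Ideal (MvPolynomial (Fin n) K)) : ℕ :=
  sSup {k | ∃ F, IsIntervalPartition I J F ∧ ∀ p ∈ F, k ≤ p.2.card}

/-- The depth of a module over `K[x_1,…,x_n]` with respect to the maximal ideal
`(x_1,…,x_n)`: the supremum of lengths of regular sequences from `(x_1,…,x_n)`. -/
noncomputable def mdepth {K : Type*} [Field K] {n : ℕ}
    (M : Type*) [AddCommGroup M] [Module (MvPolynomial (Fin n) K) M] : ℕ :=
  sSup {k | ∃ rs : List (MvPolynomial (Fin n) K), rs.length = k ∧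
    (∀ r ∈ rs, r ∈ Ideal.span (Set.range X : Set (MvPolynomial (Fin n) K))) ∧
    RingTheory.Sequence.IsRegular M rs}

/-- The `S`-module `I/J` (more precisely `I/(J ∩ I)`). -/
abbrev quotMod {K : Type*} [Field K] {n : ℕ} (I J : Ideal (MvPolynomial (Fin n) K)) :=
  I ⧸ (Submodule.comap I.subtype J)

/-- `depth_S I/J`. -/
noncomputable def depthIJ {K : Type*} [Field K] {n : ℕ}
    (I J : Ideal (MvPolynomial (Fin n) K)) : ℕ :=
  mdepth (K := K) (n := n) (quotMod I J)

/-- An ideal is a squarefree monomial ideal generated in degrees `≥ d` if it is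
the span of squarefree monomials whose supports have at least `d` elements. -/
def SqfreeGenFrom {K : Type*} [Field K] {n : ℕ}
    (L : Ideal (MvPolynomial (Fin n) K)) (d : ℕ) : Prop :=
  ∃ G : Set (Finset (Fin n)), (∀ T ∈ G, d ≤ T.card) ∧ L = Ideal.span (sqm K '' G)

/-- A squarefree monomial ideal. -/
def IsSqfreeMonomialIdeal {K : Type*} [Field K] {n : ℕ}
    (L : Ideal (MvPolynomial (Fin n) K)) : Prop :=
  ∃ G : Set (Finset (Fin n)), L = Ideal.span (sqm K '' G)

/-- The Koszul sign `(-1)^{#{i ∈ A : i < j}}`. -/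
def ksign (R : Type*) [CommRing R] {n : ℕ} (j : Fin n) (A : Finset (Fin n)) : R :=
  (-1) ^ (A.filter (· < j)).card

section Koszul

variable {R : Type*} [CommRing R] {n : ℕ} {M : Type*} [AddCommGroup M] [Module R M]

lemma ksign_mul_self (j : Fin n) (A : Finset (Fin n)) :
    ksign R j A * ksign R j A = 1 := by
  simp [ksign, ← mul_pow]

lemma ksign_swap_of_lt {A : Finset (Fin n)} {j k : Fin n} (hj : j ∈ A) (hjk : j < k) :
    ksign R j A * ksign R k (A.erase j) + ksign R k A * ksign R j (A.erase k) = 0 := by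
  have h1 : (A.erase k).filter (· < j) = A.filter (· < j) := by
    ext i; simp only [Finset.mem_filter, Finset.mem_erase]; constructor
    · tauto
    · rintro ⟨h, h'⟩; exact ⟨⟨(h'.trans hjk).ne, h⟩, h'⟩
  have h2 : (A.erase j).filter (· < k) = (A.filter (· < k)).erase j := by
    ext i; simp only [Finset.mem_filter, Finset.mem_erase]; tauto
  have h3 : (A.filter (· < k)).card = ((A.erase j).filter (· < k)).card + 1 := by
    rw [h2, Finset.card_erase_add_one]; simp [hj, hjk]
  unfold ksign
  rw [h1, h3]; ring

lemma ksign_swap {A : Finset (Fin n)} {j k : Fin n} (hj : j ∈ A) (hk : k ∈ A) (hjk : j ≠ k) :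
    ksign R j A * ksign R k (A.erase j) + ksign R k A * ksign R j (A.erase k) = 0 := by
  rcases lt_or_gt_of_ne hjk with h | h
  · exact ksign_swap_of_lt hj h
  · rw [add_comm]; exact ksign_swap_of_lt hk h

lemma ksign_ne_zero [Nontrivial R] (j : Fin n) (A : Finset (Fin n)) : ksign R j A ≠ 0 := by
  intro h
  have := ksign_mul_self (R := R) j A
  simp [h] at this

/-- The differential of the Koszul cochain complex of `x` with coefficients in `M`; cochains are
functions on the subsets of `Fin n`. -/
def koszulD (x : Fin n → R) : (Finset (Fin n) → M) →ₗ[R] (Finset (Fin n) → M) where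
  toFun ω A := ∑ j ∈ A, (ksign R j A * x j) • ω (A.erase j)
  map_add' ω θ := by
    ext A; simp [smul_add, Finset.sum_add_distrib]
  map_smul' c ω := by
    ext A
    simp only [Pi.smul_apply, RingHom.id_apply, Finset.smul_sum]
    exact Finset.sum_congr rfl fun j _ => smul_comm _ _ _

lemma koszulD_apply (x : Fin n → R) (ω : Finset (Fin n) → M) (A : Finset (Fin n)) :
    koszulD x ω A = ∑ j ∈ A, (ksign R j A * x j) • ω (A.erase j) := rfl

lemma koszulD_koszulD (x : Fin n → R) (ω : Finset (Fin n) → M) :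
    koszulD x (koszulD x ω) = 0 := by
  ext A
  simp only [koszulD_apply, Finset.smul_sum, Pi.zero_apply]
  rw [Finset.sum_sigma']
  refine Finset.sum_involution (fun p _ => ⟨p.2, p.1⟩) ?_ ?_ ?_ ?_
  · rintro ⟨j, k⟩ h
    simp only [Finset.mem_sigma, Finset.mem_erase] at h
    obtain ⟨hj, hkj, hk⟩ := h
    have := ksign_swap (R := R) hj hk (Ne.symm hkj)
    rw [Finset.erase_right_comm (a := k), smul_smul, smul_smul, ← add_smul]
    convert zero_smul R _ using 2
    linear_combination x j * x k * this
  · rintro ⟨j, k⟩ h _ h'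
    simp only [Finset.mem_sigma, Finset.mem_erase] at h
    simp only [Sigma.mk.injEq] at h'
    exact h.2.1 h'.1
  · rintro ⟨j, k⟩ h
    simp only [Finset.mem_sigma, Finset.mem_erase] at h ⊢
    exact ⟨h.2.2, Ne.symm h.2.1, h.1⟩
  · rintro ⟨j, k⟩ h; rfl

/-- Contraction of Koszul cochains with the `j`-th basis vector. -/
def koszulContract (j : Fin n) (ω : Finset (Fin n) → M) (A : Finset (Fin n)) : M :=
  if j ∈ A then 0 else ksign R j (insert j A) • ω (insert j A)

lemma koszul_homotopy (x : Fin n → R) (j : Fin n) (ω : Finset (Fin n) → M)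
    (hω : koszulD x ω = 0) :
    koszulD x (koszulContract (R := R) j ω) = x j • ω := by
  ext A
  simp only [koszulD_apply, Pi.smul_apply]
  by_cases hj : j ∈ A
  · rw [Finset.sum_eq_single_of_mem j hj]
    · simp only [koszulContract, Finset.mem_erase, ne_eq, not_true_eq_false, false_and, if_false]
      rw [Finset.insert_erase hj, smul_smul]
      congr 1
      linear_combination x j * ksign_mul_self (R := R) j A
    · intro k _ hk
      simp [koszulContract, hj, Ne.symm hk]
  · have h := congrFun hω (insert j A)
    rw [koszulD_apply, Finset.sum_insert hj, Finset.erase_insert hj, Pi.zero_apply] at h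
    have h2 := congrArg (fun t => ksign R j (insert j A) • t) h
    simp only [smul_add, smul_smul, Finset.smul_sum, smul_zero] at h2
    have h3 : ksign R j (insert j A) * (ksign R j (insert j A) * x j) = x j := by
      linear_combination x j * ksign_mul_self (R := R) j (insert j A)
    rw [h3] at h2
    rw [eq_comm, ← sub_eq_zero, ← h2, sub_eq_add_neg]
    congr 1
    rw [← Finset.sum_neg_distrib]
    refine Finset.sum_congr rfl fun k hk => ?_
    have hkj : k ≠ j := fun h => hj (h ▸ hk)
    have e1 : insert j (A.erase k) = (insert j A).erase k := by
      rw [Finset.erase_insert_of_ne hkj.symm]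
    have := ksign_swap (R := R) (Finset.mem_insert_self j A) (Finset.mem_insert_of_mem hk) hkj.symm
    rw [Finset.erase_insert hj] at this
    have hA := ksign_mul_self (R := R) j (insert j A)
    have hB := ksign_mul_self (R := R) j ((insert j A).erase k)
    simp only [koszulContract, Finset.mem_erase, hj, and_false, if_false]
    rw [e1, smul_smul, ← neg_smul]
    congr 1
    generalize ksign R j (insert j A) = a at *
    generalize ksign R k (insert j A) = b at *
    generalize ksign R j ((insert j A).erase k) = c at *
    generalize ksign R k A = e at *
    linear_combination -(x k * a * c * this) + x k * c * e * hA + x k * a * b * hB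

lemma koszul_null_homotopic (x : Fin n → R) {r : R} (hr : r ∈ Ideal.span (Set.range x))
    {i : ℕ} (ω : Finset (Fin n) → M) (hω : koszulD x ω = 0) (hi : ∀ A, A.card ≠ i → ω A = 0) :
    ∃ η : Finset (Fin n) → M, (∀ A, A.card + 1 ≠ i → η A = 0) ∧ koszulD x η = r • ω := by
  obtain ⟨g, rfl⟩ := Ideal.mem_span_range_iff_exists_fun.1 hr
  refine ⟨∑ j, g j • koszulContract (R := R) j ω, fun A hA => ?_, ?_⟩
  · rw [Finset.sum_apply]
    refine Finset.sum_eq_zero fun j _ => ?_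
    by_cases hj : j ∈ A
    · simp [koszulContract, hj]
    · simp [koszulContract, hj, hi (insert j A) (by rwa [Finset.card_insert_of_notMem hj])]
  · simp [map_sum, koszul_homotopy x _ ω hω, Finset.sum_smul, smul_smul]

/-- Koszul cohomology of `x` vanishes below the length of a weakly regular sequence contained in
the ideal generated by `x`. -/
theorem koszul_exact_of_isWeaklyRegular (x : Fin n → R) (rs : List R) :
    ∀ (M : Type*) [AddCommGroup M] [Module R M],
    RingTheory.Sequence.IsWeaklyRegular M rs →
    (∀ r ∈ rs, r ∈ Ideal.span (Set.range x)) → ∀ i < rs.length, ∀ ω : Finset (Fin n) → M,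
    (∀ A, A.card ≠ i → ω A = 0) → koszulD x ω = 0 →
    ∃ θ : Finset (Fin n) → M, (∀ A, A.card + 1 ≠ i → θ A = 0) ∧ koszulD x θ = ω := by
  induction rs with
  | nil => intro M _ _ _ _ i hi; simp at hi
  | cons r rs ih =>
    intro M _ _ hreg hmem i hi ω hωi hω
    rw [RingTheory.Sequence.isWeaklyRegular_cons_iff] at hreg
    obtain ⟨η, hηi, hη⟩ := koszul_null_homotopic x (hmem r (by simp)) ω hω hωi
    rcases i with _ | i
    · have h0 : η = 0 := funext fun A => hηi A (by simp)
      refine ⟨0, fun _ _ => rfl, ?_⟩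
      rw [h0, map_zero] at hη
      ext A
      have := congrFun hη A
      simp only [Pi.zero_apply, Pi.smul_apply] at this
      rw [map_zero, Pi.zero_apply]
      exact hreg.1 (by simpa using this)
    · let π : M →ₗ[R] QuotSMulTop r M := Submodule.mkQ _
      have hcomp : ∀ ξ : Finset (Fin n) → M, koszulD x (fun A => π (ξ A)) =
          fun A => π (koszulD x ξ A) := by
        intro ξ; ext A; simp [koszulD_apply, map_sum]
      have hker : ∀ m : M, π m = 0 → ∃ m' : M, m = r • m' := by
        intro m hm
        have := (Submodule.Quotient.mk_eq_zero _).1 hm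
        obtain ⟨m', -, h⟩ := Submodule.mem_smul_pointwise_iff_exists _ _ _ |>.1 this
        exact ⟨m', h.symm⟩
      obtain ⟨ζ', hζi, hζ⟩ := ih (QuotSMulTop r M) hreg.2 (fun s hs => hmem s (by simp [hs])) i
        (by simpa using hi) (fun A => π (η A))
        (fun A hA => by rw [hηi A (by simpa using hA), map_zero]) (by
          rw [hcomp, hη]; ext A
          simp only [Pi.smul_apply, Pi.zero_apply]
          exact (Submodule.Quotient.mk_eq_zero _).2
            (Submodule.smul_mem_pointwise_smul _ _ _ trivial))
      have hlift : ∀ A, ∃ m : M, π m = ζ' A ∧ (A.card + 1 ≠ i → m = 0) := by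
        intro A
        by_cases hA : A.card + 1 = i
        · obtain ⟨m, hm⟩ := Submodule.mkQ_surjective _ (ζ' A)
          exact ⟨m, hm, fun h => (h hA).elim⟩
        · exact ⟨0, by rw [map_zero, hζi A hA], fun _ => rfl⟩
      choose ζ hζ1 hζ2 using hlift
      have hdiff : ∀ A, ∃ m : M, η A - koszulD x ζ A = r • m ∧ (A.card ≠ i → m = 0) := by
        intro A
        by_cases hA : A.card = i
        · obtain ⟨m, hm⟩ := hker (η A - koszulD x ζ A) (by
            have h1 := congrFun (hcomp ζ) A
            simp only [hζ1] at h1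
            rw [map_sub, ← h1, sub_eq_zero]
            exact (congrFun hζ A).symm)
          exact ⟨m, hm, fun h => (h hA).elim⟩
        · refine ⟨0, ?_, fun _ => rfl⟩
          rw [hηi A (by simpa using hA), koszulD_apply, Finset.sum_eq_zero, sub_zero, smul_zero]
          intro j hj
          rw [hζ2 _ (by rwa [Finset.card_erase_add_one hj]), smul_zero]
      choose θ hθ1 hθ2 using hdiff
      refine ⟨θ, fun A hA => hθ2 A (by simpa using hA), ?_⟩
      have h1 : η = koszulD x ζ + r • θ := by
        ext A; simp only [Pi.add_apply, Pi.smul_apply, ← hθ1]; abel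
      rw [h1, map_add, koszulD_koszulD, zero_add, map_smul] at hη
      ext A
      exact hreg.1 (congrFun hη A)

end Koszul

section Monomial

variable {K : Type*} [Field K] {n : ℕ}

/-- The exponent vector of the squarefree monomial with support `T`. -/
noncomputable def sqExp (T : Finset (Fin n)) : Fin n →₀ ℕ := ∑ i ∈ T, Finsupp.single i 1

lemma sqExp_apply (T : Finset (Fin n)) (i : Fin n) : sqExp T i = if i ∈ T then 1 else 0 := by
  simp [sqExp, Finsupp.finsetSum_apply, Finsupp.single_apply]

lemma sqm_eq_monomial (T : Finset (Fin n)) : sqm K T = monomial (sqExp T) 1 := by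
  rw [sqm, sqExp, MvPolynomial.monomial_sum_one]; rfl

lemma sqExp_le_sqExp {S T : Finset (Fin n)} : sqExp S ≤ sqExp T ↔ S ⊆ T := by
  constructor
  · intro h i hi
    have := h i
    rw [sqExp_apply, sqExp_apply, if_pos hi] at this
    by_contra h'
    simp [h'] at this
  · intro h i
    rw [sqExp_apply, sqExp_apply]
    split_ifs with h1 h2 <;> simp
    exact h2 (h h1)

lemma exists_subset_of_coeff_ne_zero {G : Set (Finset (Fin n))} {p : MvPolynomial (Fin n) K}
    (hp : p ∈ Ideal.span (sqm K '' G)) {T : Finset (Fin n)} (hT : coeff (sqExp T) p ≠ 0) :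
    ∃ g ∈ G, g ⊆ T := by
  have h : sqm K '' G = (fun s => monomial s (1 : K)) '' (sqExp '' G) := by
    rw [Set.image_image]; exact Set.image_congr fun T _ => sqm_eq_monomial T
  rw [h, mem_ideal_span_monomial_image] at hp
  obtain ⟨_, ⟨g, hg, rfl⟩, hle⟩ := hp _ (mem_support_iff.2 hT)
  exact ⟨g, hg, sqExp_le_sqExp.1 hle⟩

lemma sqm_mem_of_subset {L : Ideal (MvPolynomial (Fin n) K)} {S T : Finset (Fin n)}
    (hS : sqm K S ∈ L) (h : S ⊆ T) : sqm K T ∈ L := by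
  have : sqm K T = (∏ i ∈ T \ S, X i) * sqm K S := (Finset.prod_sdiff h).symm
  rw [this]; exact L.mul_mem_left _ hS

lemma coeff_sqm (T : Finset (Fin n)) : coeff (sqExp T) (sqm K T) = 1 := by
  rw [sqm_eq_monomial, coeff_monomial, if_pos rfl]

lemma sqm_mem_span_iff {G : Set (Finset (Fin n))} {T : Finset (Fin n)} :
    sqm K T ∈ Ideal.span (sqm K '' G) ↔ ∃ g ∈ G, g ⊆ T := by
  constructor
  · intro h
    exact exists_subset_of_coeff_ne_zero h (by rw [coeff_sqm]; exact one_ne_zero)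
  · rintro ⟨g, hg, h⟩
    exact sqm_mem_of_subset (Ideal.subset_span ⟨g, hg, rfl⟩) h

lemma X_mul_sqm_erase {T : Finset (Fin n)} {k : Fin n} (hk : k ∈ T) :
    X k * sqm K (T.erase k) = sqm K T :=
  Finset.mul_prod_erase T (fun i => (X i : MvPolynomial (Fin n) K)) hk

lemma coeff_sqExp_X_mul (T : Finset (Fin n)) (k : Fin n) (q : MvPolynomial (Fin n) K) :
    coeff (sqExp T) (X k * q) = if k ∈ T then coeff (sqExp (T.erase k)) q else 0 := by
  rw [coeff_X_mul']
  have : k ∈ (sqExp T).support ↔ k ∈ T := by simp [sqExp_apply]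
  simp only [this]
  split_ifs with h
  · congr 1
    ext i
    rw [Finsupp.tsub_apply, sqExp_apply, sqExp_apply, Finsupp.single_apply]
    by_cases hi : k = i
    · subst hi; simp [h]
    · simp [hi, Ne.symm hi]
  · rfl

lemma ksign_eq_C (j : Fin n) (A : Finset (Fin n)) :
    ksign (MvPolynomial (Fin n) K) j A = C (ksign K j A) := by
  simp [ksign]

lemma mem_sqPoset_of_subset {I J : Ideal (MvPolynomial (Fin n) K)} {S T : Finset (Fin n)}
    (hS : S ∈ sqPoset I J) (h : S ⊆ T) (hT : sqm K T ∉ J) : T ∈ sqPoset I J :=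
  ⟨sqm_mem_of_subset hS.1 h, hT⟩

/-- Vanishing of the `i`-th Koszul cohomology of `I/J`, written in terms of polynomials. -/
def KoszulVanish (I J : Ideal (MvPolynomial (Fin n) K)) (i : ℕ) : Prop :=
  ∀ p : Finset (Fin n) → MvPolynomial (Fin n) K, (∀ A, p A ∈ I) → (∀ A, A.card ≠ i → p A = 0) →
    (∀ T, koszulD (X : Fin n → MvPolynomial (Fin n) K) p T ∈ J) →
    ∃ q : Finset (Fin n) → MvPolynomial (Fin n) K, (∀ A, q A ∈ I) ∧
      (∀ A, A.card + 1 ≠ i → q A = 0) ∧ ∀ T, p T - koszulD (X : Fin n → MvPolynomial (Fin n) K) q T ∈ J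

lemma koszulVanish_of_lt_depthIJ {I J : Ideal (MvPolynomial (Fin n) K)} {i : ℕ}
    (h : i < depthIJ I J) : KoszulVanish I J i := by
  unfold depthIJ mdepth at h
  obtain ⟨k, ⟨rs, rfl, hmem, hreg⟩, hk⟩ := exists_lt_of_lt_csSup (by
    by_contra hne
    rw [Set.not_nonempty_iff_eq_empty] at hne
    rw [hne] at h
    simp at h) h
  intro p hpI hpi hpJ
  let π : I →ₗ[MvPolynomial (Fin n) K] quotMod I J := Submodule.mkQ _
  have hπ : ∀ m : I, π m = 0 ↔ (m : MvPolynomial (Fin n) K) ∈ J := fun m =>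
    Submodule.Quotient.mk_eq_zero _
  have hcoe : ∀ q : Finset (Fin n) → I, ∀ T,
      koszulD (X : Fin n → MvPolynomial (Fin n) K) (fun A => π (q A)) T = π (koszulD (X : Fin n → MvPolynomial (Fin n) K) q T) := fun q T => by
    simp [koszulD_apply, map_sum]
  have hcoe2 : ∀ q : Finset (Fin n) → I, ∀ T,
      koszulD (X : Fin n → MvPolynomial (Fin n) K) (fun A => (q A : MvPolynomial (Fin n) K)) T = (koszulD (X : Fin n → MvPolynomial (Fin n) K) q T : I) := fun q T => by
    simp [koszulD_apply]
  obtain ⟨θ, hθi, hθ⟩ := koszul_exact_of_isWeaklyRegular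
    (X : Fin n → MvPolynomial (Fin n) K) rs (quotMod I J) hreg.toIsWeaklyRegular
    hmem i hk (fun A => π ⟨p A, hpI A⟩)
    (fun A hA => by rw [hπ]; simp [hpi A hA]) (by
      ext T
      rw [hcoe, Pi.zero_apply, hπ, ← hcoe2]
      exact hpJ T)
  have hlift : ∀ A, ∃ m : I, π m = θ A ∧ (A.card + 1 ≠ i → m = 0) := by
    intro A
    by_cases hA : A.card + 1 = i
    · obtain ⟨m, hm⟩ := Submodule.mkQ_surjective _ (θ A)
      exact ⟨m, hm, fun h => (h hA).elim⟩
    · exact ⟨0, by rw [map_zero, hθi A hA], fun _ => rfl⟩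
  choose q hq1 hq2 using hlift
  refine ⟨fun A => q A, fun A => (q A).2, fun A hA => by simp [hq2 A hA], fun T => ?_⟩
  have h1 := congrFun hθ T
  rw [← funext hq1, hcoe] at h1
  rw [hcoe2]
  have := (hπ (⟨p T, hpI T⟩ - koszulD (X : Fin n → MvPolynomial (Fin n) K) q T)).1 (by rw [map_sub, h1, sub_self])
  simpa using this

variable {I J : Ideal (MvPolynomial (Fin n) K)} {d : ℕ}

lemma coeff_eq_zero_of_mem {G : Set (Finset (Fin n))} (hJ : J = Ideal.span (sqm K '' G))
    {T : Finset (Fin n)} (hT : sqm K T ∉ J) {p : MvPolynomial (Fin n) K} (hp : p ∈ J) :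
    coeff (sqExp T) p = 0 := by
  by_contra h
  subst hJ
  exact hT (sqm_mem_span_iff.2 (exists_subset_of_coeff_ne_zero hp h))

lemma coeff_koszulD (q : Finset (Fin n) → MvPolynomial (Fin n) K) (T A : Finset (Fin n)) :
    coeff (sqExp T) (koszulD (X : Fin n → MvPolynomial (Fin n) K) q A) =
      ∑ k ∈ A, ksign K k A * if k ∈ T then coeff (sqExp (T.erase k)) (q (A.erase k)) else 0 := by
  rw [koszulD_apply, coeff_sum]
  refine Finset.sum_congr rfl fun k _ => ?_
  rw [smul_eq_mul, ksign_eq_C, mul_assoc, coeff_C_mul, coeff_sqExp_X_mul]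

/-- The differential of the simplicial cochain complex of the full simplex on `Fin n`. -/
abbrev coboundary (K : Type*) [Field K] (n : ℕ) :
    (Finset (Fin n) → K) →ₗ[K] (Finset (Fin n) → K) := koszulD (fun _ => 1)

lemma coboundary_apply (a : Finset (Fin n) → K) (T : Finset (Fin n)) :
    coboundary K n a T = ∑ k ∈ T, ksign K k T * a (T.erase k) := by
  simp [coboundary, koszulD_apply]

lemma exists_erase_of_coboundary_ne_zero {a : Finset (Fin n) → K} {T : Finset (Fin n)}
    (h : coboundary K n a T ≠ 0) : ∃ k ∈ T, a (T.erase k) ≠ 0 := by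
  rw [coboundary_apply] at h
  obtain ⟨k, hk, h⟩ := Finset.exists_ne_zero_of_sum_ne_zero h
  exact ⟨k, hk, right_ne_zero_of_mul h⟩

lemma exists_coboundary_eq_of_koszulVanish {G H : Set (Finset (Fin n))}
    (hI : I = Ideal.span (sqm K '' G)) (hJ : J = Ideal.span (sqm K '' H))
    (hG : ∀ g ∈ G, d ≤ g.card) (hv : KoszulVanish I J (d + 1))
    (lam : Finset (Fin n) → K) (hlam : ∀ b, lam b ≠ 0 → b ∈ degSet I J (d + 1))
    (hz : ∀ c ∈ degSet I J (d + 2), coboundary K n lam c = 0) :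
    ∃ a : Finset (Fin n) → K, (∀ A, a A ≠ 0 → A ∈ G ∧ A.card = d) ∧
      ∀ b ∈ degSet I J (d + 1), lam b = coboundary K n a b := by
  obtain ⟨q, hqI, hqi, hq⟩ := hv (fun A => C (lam A) * sqm K A) (fun A => by
      by_cases h : lam A = 0
      · simp [h]
      · exact I.mul_mem_left _ (hlam A h).1.1)
    (fun A hA => by
      by_cases h : lam A = 0
      · simp [h]
      · exact (hA (hlam A h).2).elim)
    (fun T => by
      have h1 : koszulD (X : Fin n → MvPolynomial (Fin n) K) (fun A => C (lam A) * sqm K A) T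
          = C (coboundary K n lam T) * sqm K T := by
        rw [koszulD_apply, coboundary_apply, map_sum, Finset.sum_mul]
        refine Finset.sum_congr rfl fun k hk => ?_
        rw [← X_mul_sqm_erase hk, smul_eq_mul, ksign_eq_C, C_mul]
        ring
      rw [h1]
      by_cases h : coboundary K n lam T = 0
      · simp [h]
      · obtain ⟨k, hk, hk'⟩ := exists_erase_of_coboundary_ne_zero h
        obtain ⟨hP, hc⟩ := hlam _ hk'
        refine J.mul_mem_left _ ?_
        by_contra hTJ
        refine h (hz T ⟨mem_sqPoset_of_subset hP (Finset.erase_subset _ _) hTJ, ?_⟩)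
        rw [← Finset.card_erase_add_one hk, hc])
  refine ⟨fun A => coeff (sqExp A) (q A), fun A hA => ?_, fun b hb => ?_⟩
  · have hc : A.card = d := by
      by_contra h
      exact hA (by simp [hqi A (by simpa using h)])
    have := hqI A
    rw [hI] at this
    obtain ⟨g, hg, hgA⟩ := exists_subset_of_coeff_ne_zero this hA
    have := Finset.eq_of_subset_of_card_le hgA (hc ▸ hG g hg)
    exact ⟨this ▸ hg, hc⟩
  · have := coeff_eq_zero_of_mem hJ hb.1.2 (hq b)
    rw [coeff_sub, coeff_C_mul, coeff_sqm, mul_one, sub_eq_zero, coeff_koszulD] at this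
    rw [this, coboundary_apply]
    exact Finset.sum_congr rfl fun k hk => by rw [if_pos hk]

lemma eq_zero_of_koszulVanish {G H : Set (Finset (Fin n))}
    (hI : I = Ideal.span (sqm K '' G)) (hJ : J = Ideal.span (sqm K '' H))
    (hG : ∀ g ∈ G, d ≤ g.card) (hv : KoszulVanish I J (d + 1)) (j : Fin n)
    (a : Finset (Fin n) → K) (ha : ∀ T, a T ≠ 0 → T ∈ degSet I J d ∧ j ∉ T)
    (hz : ∀ b ∈ degSet I J (d + 1), j ∉ b → coboundary K n a b = 0) : a = 0 := by
  let p : Finset (Fin n) → MvPolynomial (Fin n) K := fun A =>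
    if j ∈ A then C (ksign K j A * a (A.erase j)) * sqm K (A.erase j) else 0
  obtain ⟨q, hqI, hqi, hq⟩ := hv p (fun A => by
      by_cases hj : j ∈ A
      · by_cases h : a (A.erase j) = 0
        · simp [p, h]
        · simp only [p, if_pos hj]
          exact I.mul_mem_left _ (ha _ h).1.1.1
      · simp [p, hj])
    (fun A hA => by
      by_cases hj : j ∈ A
      · by_cases h : a (A.erase j) = 0
        · simp [p, h]
        · refine (hA ?_).elim
          rw [← Finset.card_erase_add_one hj, (ha _ h).1.2]
      · simp [p, hj])
    (fun T => by
      by_cases hj : j ∈ T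
      · have h1 : koszulD (X : Fin n → MvPolynomial (Fin n) K) p T
            = C (-(ksign K j T * coboundary K n a (T.erase j))) * sqm K (T.erase j) := by
          rw [koszulD_apply, coboundary_apply, ← Finset.add_sum_erase _ _ hj]
          have : p (T.erase j) = 0 := by simp [p]
          rw [this, smul_zero, zero_add, Finset.mul_sum, ← Finset.sum_neg_distrib, map_sum,
            Finset.sum_mul]
          refine Finset.sum_congr rfl fun k hk => ?_
          obtain ⟨hkj, hkT⟩ := Finset.mem_erase.1 hk
          have hs := ksign_swap (R := K) hj hkT hkj.symm
          simp only [p, Finset.mem_erase, hj, hkj.symm, ne_eq, not_false_eq_true, and_self, if_true]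
          rw [← X_mul_sqm_erase hk, smul_eq_mul, ksign_eq_C, Finset.erase_right_comm (a := k)]
          have hs' : -(ksign K j T * (ksign K k (T.erase j) * a ((T.erase j).erase k))) =
              ksign K k T * (ksign K j (T.erase k) * a ((T.erase j).erase k)) := by
            linear_combination (-a ((T.erase j).erase k)) * hs
          rw [hs']
          simp only [C_mul]
          ring
        rw [h1]
        by_cases h : coboundary K n a (T.erase j) = 0
        · simp [h]
        · obtain ⟨k, hk, hk'⟩ := exists_erase_of_coboundary_ne_zero h
          obtain ⟨⟨hP, hc⟩, -⟩ := ha _ hk'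
          refine J.mul_mem_left _ ?_
          by_contra hTJ
          refine h (hz _ ⟨mem_sqPoset_of_subset hP (Finset.erase_subset _ _) hTJ, ?_⟩ (by simp))
          rw [← Finset.card_erase_add_one hk, hc]
      · have : koszulD (X : Fin n → MvPolynomial (Fin n) K) p T = 0 := by
          rw [koszulD_apply]
          refine Finset.sum_eq_zero fun k _ => ?_
          simp [p, hj]
        rw [this]; exact J.zero_mem)
  ext T
  by_contra hT
  obtain ⟨⟨hP, hc⟩, hjT⟩ := ha T hT
  have := coeff_eq_zero_of_mem hJ hP.2 (hq (insert j T))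
  rw [coeff_sub, coeff_koszulD, Finset.sum_eq_zero, sub_zero] at this
  · simp only [p, Finset.mem_insert_self, if_true, Finset.erase_insert hjT, coeff_C_mul,
      coeff_sqm, mul_one] at this
    exact hT ((mul_eq_zero.1 this).resolve_left (ksign_ne_zero _ _))
  · intro k _
    split_ifs with hk
    · by_cases h : coeff (sqExp (T.erase k)) (q ((insert j T).erase k)) = 0
      · rw [h, mul_zero]
      · have hmem := hqI ((insert j T).erase k)
        rw [hI] at hmem
        obtain ⟨g, hg, hgT⟩ := exists_subset_of_coeff_ne_zero hmem h
        have h1 := hG g hg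
        have h2 := Finset.card_le_card hgT
        have h3 := Finset.card_erase_add_one hk
        omega
    · rw [mul_zero]

end Monomial

section Coloring

/-- Given linear conditions each of which is a sum of several linear forms, one can select a single
summand from each condition without enlarging the space of common solutions. -/
lemma exists_choice_of_sum_forms {K E ι κ : Type*} [Field K] [AddCommGroup E] [Module K E]
    [Fintype κ] [Nonempty κ] (φ : ι → κ → E →ₗ[K] K) (N : Submodule K E) (D : Finset ι) :
    ∀ W : Submodule K E, (∀ v ∈ N, ∀ c ∈ D, ∀ k, φ c k v = 0) →
      (∀ v ∈ W, (∀ c ∈ D, ∑ k, φ c k v = 0) → v ∈ N) →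
      ∃ γ : ι → κ, ∀ v ∈ W, (∀ c ∈ D, φ c (γ c) v = 0) → v ∈ N := by
  classical
  induction D using Finset.induction_on with
  | empty =>
    intro W _ hW
    exact ⟨fun _ => Classical.arbitrary κ, fun v hv _ => hW v hv (by simp)⟩
  | insert c₀ D hc₀ ih =>
    intro W hN hW
    have key : ∃ k, ∀ v ∈ W, φ c₀ k v = 0 → (∀ c ∈ D, ∑ k, φ c k v = 0) → v ∈ N := by
      by_cases h : ∀ v ∈ W, (∀ c ∈ D, ∑ k, φ c k v = 0) → v ∈ N
      · exact ⟨Classical.arbitrary κ, fun v hv _ => h v hv⟩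
      · push Not at h
        obtain ⟨u, huW, hu, huN⟩ := h
        have h0 : ∑ k, φ c₀ k u ≠ 0 := fun h0 => huN (hW u huW (by
          intro c hc
          rcases Finset.mem_insert.1 hc with rfl | hc
          · exact h0
          · exact hu c hc))
        obtain ⟨k, -, hk⟩ := Finset.exists_ne_zero_of_sum_ne_zero h0
        refine ⟨k, fun v hv hkv hD => hW v hv fun c hc => ?_⟩
        rcases Finset.mem_insert.1 hc with rfl | hc
        · have hmem := hW ((∑ k, φ c k v) • u - (∑ k, φ c k u) • v)
            (W.sub_mem (W.smul_mem _ huW) (W.smul_mem _ hv)) (by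
              intro c' hc'
              simp only [map_sub, map_smul, smul_eq_mul, Finset.sum_sub_distrib, ← Finset.mul_sum]
              rcases Finset.mem_insert.1 hc' with rfl | hc'
              · ring
              · rw [hu c' hc', hD c' hc']; ring)
          have := hN _ hmem c (Finset.mem_insert_self _ _) k
          rw [map_sub, map_smul, map_smul, hkv, smul_zero, sub_zero, smul_eq_mul] at this
          exact (mul_eq_zero.1 this).resolve_right hk
        · exact hD c hc
    obtain ⟨k, hk⟩ := key
    obtain ⟨γ, hγ⟩ := ih (W ⊓ LinearMap.ker (φ c₀ k))
      (fun v hv c hc => hN v hv c (Finset.mem_insert_of_mem hc))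
      (fun v hv hD => hk v hv.1 hv.2 hD)
    refine ⟨Function.update γ c₀ k, fun v hv h => hγ v ⟨hv, ?_⟩ fun c hc => ?_⟩
    · simpa using h c₀ (Finset.mem_insert_self _ _)
    · have hne : c ≠ c₀ := fun h => hc₀ (h ▸ hc)
      simpa [hne] using h c (Finset.mem_insert_of_mem hc)

end Coloring

section Levels

variable {K : Type*} [Field K] {n d : ℕ}

/-- Restriction of a cochain to the faces satisfying `P`. -/
def cochainMask (P : Finset (Fin n) → Prop) [DecidablePred P] :
    (Finset (Fin n) → K) →ₗ[K] (Finset (Fin n) → K) where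
  toFun a b := if P b then a b else 0
  map_add' a a' := by ext b; by_cases h : P b <;> simp [h]
  map_smul' r a := by ext b; by_cases h : P b <;> simp [h]

lemma cochainMask_apply (P : Finset (Fin n) → Prop) [DecidablePred P] (a : Finset (Fin n) → K)
    (b : Finset (Fin n)) : cochainMask P a b = if P b then a b else 0 := rfl

lemma coboundary_congr {a a' : Finset (Fin n) → K} {b : Finset (Fin n)}
    (h : ∀ k ∈ b, a (b.erase k) = a' (b.erase k)) : coboundary K n a b = coboundary K n a' b := by
  rw [coboundary_apply, coboundary_apply]
  exact Finset.sum_congr rfl fun k hk => by rw [h k hk]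

lemma coboundary_eq_zero_of_forall {a : Finset (Fin n) → K} {b : Finset (Fin n)}
    (h : ∀ k ∈ b, a (b.erase k) = 0) : coboundary K n a b = 0 := by
  by_contra h'
  obtain ⟨k, hk, hk'⟩ := exists_erase_of_coboundary_ne_zero h'
  exact hk' (h k hk)

lemma coboundary_eq_of_forall_ne {a : Finset (Fin n) → K} {b : Finset (Fin n)} {p : Fin n}
    (hp : p ∈ b) (h : ∀ k ∈ b, k ≠ p → a (b.erase k) = 0) :
    coboundary K n a b = ksign K p b * a (b.erase p) := by
  rw [coboundary_apply, Finset.sum_eq_single_of_mem p hp]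
  intro k hk hkp
  rw [h k hk hkp, mul_zero]

lemma exists_eq_erase {f b : Finset (Fin n)} (h : f ⊆ b) (hc : b.card = f.card + 1) :
    ∃ p ∈ b, p ∉ f ∧ f = b.erase p := by
  have : (b \ f).card = 1 := by rw [Finset.card_sdiff_of_subset h]; omega
  obtain ⟨p, hp⟩ := Finset.card_eq_one.1 this
  have hp' : p ∈ b \ f := by rw [hp]; simp
  rw [Finset.mem_sdiff] at hp'
  refine ⟨p, hp'.1, hp'.2, Finset.eq_of_subset_of_card_le ?_ ?_⟩
  · exact Finset.subset_erase.2 ⟨h, hp'.2⟩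
  · rw [Finset.card_erase_of_mem hp'.1]; omega

/-- The combinatorial data extracted from the squarefree monomials of degrees `d`, `d + 1` and
`d + 2` in `I \ J` when the Koszul cohomology of `I/J` vanishes in degree `d + 1`. -/
structure LevelData (K : Type*) [Field K] (n d : ℕ) (F B C : Finset (Finset (Fin n))) :
    Prop where
  lt : d < n
  cardF : ∀ f ∈ F, f.card = d
  cardB : ∀ b ∈ B, b.card = d + 1
  cardC : ∀ c ∈ C, c.card = d + 2
  mem_mid : ∀ c ∈ C, ∀ b ⊆ c, b.card = d + 1 → ∀ f ∈ F, f ⊆ b → b ∈ B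
  eq_zero : ∀ (j : Fin n) (a : Finset (Fin n) → K), (∀ f, a f ≠ 0 → f ∈ F ∧ j ∉ f) →
    (∀ b ∈ B, j ∉ b → coboundary K n a b = 0) → a = 0

/-- The rows `R` and columns `D` determine cochains up to coboundaries of cochains on `Q`. -/
def ExactOn (K : Type*) [Field K] {n : ℕ} (B Q R D : Finset (Finset (Fin n))) : Prop :=
  ∀ l : Finset (Fin n) → K, (∀ b, l b ≠ 0 → b ∈ R) → (∀ c ∈ D, coboundary K n l c = 0) →
    ∃ a : Finset (Fin n) → K, (∀ f, a f ≠ 0 → f ∈ Q) ∧ ∀ b ∈ B, l b = coboundary K n a b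

/-- A system of intervals `[f, h f]` and `[b, g b]` with tops in `D` that covers `Q` and `R`. -/
def Matchable {n : ℕ} (d : ℕ) (Q R D : Finset (Finset (Fin n))) : Prop :=
  ∃ g h : Finset (Fin n) → Finset (Fin n),
    (∀ b ∈ R, g b ∈ D ∧ b ⊆ g b) ∧
    (∀ f ∈ Q, h f ∈ D ∧ f ⊆ h f ∧
      ∀ b : Finset (Fin n), b.card = d + 1 → f ⊆ b → b ⊆ h f → b ∈ R ∧ g b = h f) ∧
    (∀ f ∈ Q, ∀ f' ∈ Q, h f = h f' → f = f') ∧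
    (∀ b ∈ R, ∀ b' ∈ R, g b = g b' → b = b' ∨ ∃ f ∈ Q, f ⊆ b ∧ f ⊆ b' ∧ h f = g b)

lemma Matchable.union {Q₁ Q₂ R₁ R₂ D₁ D₂ D : Finset (Finset (Fin n))}
    (h₁ : Matchable d Q₁ R₁ D₁) (h₂ : Matchable d Q₂ R₂ D₂)
    (hQ : Disjoint Q₁ Q₂) (hR : Disjoint R₁ R₂) (hD : Disjoint D₁ D₂) (hD₁ : D₁ ⊆ D)
    (hD₂ : D₂ ⊆ D) : Matchable d (Q₁ ∪ Q₂) (R₁ ∪ R₂) D := by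
  obtain ⟨g₁, k₁, a₁, b₁, c₁, e₁⟩ := h₁
  obtain ⟨g₂, k₂, a₂, b₂, c₂, e₂⟩ := h₂
  have hQ' : ∀ f ∈ Q₂, f ∉ Q₁ := fun f h h' => Finset.disjoint_left.1 hQ h' h
  have hR' : ∀ f ∈ R₂, f ∉ R₁ := fun f h h' => Finset.disjoint_left.1 hR h' h
  have hD' : ∀ c ∈ D₁, ∀ c' ∈ D₂, c ≠ c' := fun c hc c' hc' h =>
    Finset.disjoint_left.1 hD hc (h ▸ hc')
  refine ⟨fun b => if b ∈ R₁ then g₁ b else g₂ b, fun f => if f ∈ Q₁ then k₁ f else k₂ f,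
    fun b hb => ?_, fun f hf => ?_, fun f hf f' hf' => ?_, fun b hb b' hb' => ?_⟩
  · rcases Finset.mem_union.1 hb with h | h
    · simp only [h, if_true]; exact ⟨hD₁ (a₁ b h).1, (a₁ b h).2⟩
    · simp only [hR' b h, if_false]; exact ⟨hD₂ (a₂ b h).1, (a₂ b h).2⟩
  · rcases Finset.mem_union.1 hf with h | h
    · simp only [h, if_true]
      obtain ⟨x, y, z⟩ := b₁ f h
      refine ⟨hD₁ x, y, fun b hb h1 h2 => ?_⟩
      obtain ⟨u, v⟩ := z b hb h1 h2
      simp only [u, if_true, v, Finset.mem_union, true_or, and_self]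
    · simp only [hQ' f h, if_false]
      obtain ⟨x, y, z⟩ := b₂ f h
      refine ⟨hD₂ x, y, fun b hb h1 h2 => ?_⟩
      obtain ⟨u, v⟩ := z b hb h1 h2
      simp only [hR' b u, if_false, v, Finset.mem_union, u, or_true, and_self]
  · rcases Finset.mem_union.1 hf with h | h <;> rcases Finset.mem_union.1 hf' with h' | h'
    · simp only [h, h', if_true]; exact c₁ f h f' h'
    · simp only [h, hQ' f' h', if_true, if_false]
      exact fun e => (hD' _ (b₁ f h).1 _ (b₂ f' h').1 e).elim
    · simp only [h', hQ' f h, if_true, if_false]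
      exact fun e => (hD' _ (b₁ f' h').1 _ (b₂ f h).1 e.symm).elim
    · simp only [hQ' f h, hQ' f' h', if_false]; exact c₂ f h f' h'
  · rcases Finset.mem_union.1 hb with h | h <;> rcases Finset.mem_union.1 hb' with h' | h'
    · simp only [h, h', if_true]
      intro e
      refine (e₁ b h b' h' e).imp id ?_
      rintro ⟨f, hf, x, y, z⟩
      exact ⟨f, Finset.mem_union_left _ hf, x, y, by simp [hf, z]⟩
    · simp only [h, hR' b' h', if_true, if_false]
      exact fun e => (hD' _ (a₁ b h).1 _ (a₂ b' h').1 e).elim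
    · simp only [h', hR' b h, if_true, if_false]
      exact fun e => (hD' _ (a₁ b' h').1 _ (a₂ b h).1 e.symm).elim
    · simp only [hR' b h, hR' b' h', if_false]
      intro e
      refine (e₂ b h b' h' e).imp id ?_
      rintro ⟨f, hf, x, y, z⟩
      exact ⟨f, Finset.mem_union_right _ hf, x, y, by simp [hQ' f hf, z]⟩

/-- The linear form `l ↦ ∂ (l restricted to the rows of colour k) c`. -/
noncomputable def colorForm {κ : Type*} [DecidableEq κ] (col : Finset (Fin n) → κ)
    (c : Finset (Fin n)) (k : κ) : (Finset (Fin n) → K) →ₗ[K] K :=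
  LinearMap.proj c ∘ₗ coboundary K n ∘ₗ cochainMask (fun b => col b = k)

lemma colorForm_apply {κ : Type*} [DecidableEq κ] (col : Finset (Fin n) → κ)
    (c : Finset (Fin n)) (k : κ) (l : Finset (Fin n) → K) :
    colorForm col c k l = coboundary K n (cochainMask (fun b => col b = k) l) c := rfl

lemma sum_colorForm {κ : Type*} [DecidableEq κ] [Fintype κ] (col : Finset (Fin n) → κ)
    (c : Finset (Fin n)) (l : Finset (Fin n) → K) :
    ∑ k, colorForm col c k l = coboundary K n l c := by
  simp only [colorForm_apply, coboundary_apply, cochainMask_apply]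
  rw [Finset.sum_comm]
  refine Finset.sum_congr rfl fun j _ => ?_
  rw [← Finset.mul_sum]
  simp

/-- The cochains supported on `R`. -/
def supportedOn (K : Type*) [Field K] {n : ℕ} (R : Finset (Finset (Fin n))) :
    Submodule K (Finset (Fin n) → K) where
  carrier := {l | ∀ b, l b ≠ 0 → b ∈ R}
  zero_mem' := fun b h => (h rfl).elim
  add_mem' := by
    intro l l' h h' b hb
    by_cases h0 : l b = 0
    · exact h' b fun h1 => hb (by simp [h0, h1])
    · exact h b h0
  smul_mem' := by
    intro r l h b hb
    exact h b fun h0 => hb (by simp [h0])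

lemma ExactOn.matchable {B R D : Finset (Finset (Fin n))} (hRB : R ⊆ B)
    (h : ExactOn K B ∅ R D) : Matchable d ∅ R D := by
  obtain ⟨γ, hγ⟩ := exists_choice_of_sum_forms
    (colorForm (K := K) (n := n) (id : Finset (Fin n) → Finset (Fin n))) ⊥ D (supportedOn K R)
    (by simp) (by
      intro l hl hD
      simp only [sum_colorForm] at hD
      obtain ⟨a, ha, hla⟩ := h l hl hD
      have ha0 : a = 0 := by
        ext f; by_contra hf; simpa using ha f hf
      rw [Submodule.mem_bot]
      ext b
      by_contra hb
      exact hb (by rw [hla b (hRB (hl b hb)), ha0, map_zero]))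
  have hex : ∀ b ∈ R, ∃ c ∈ D, γ c = b ∧ b ⊆ c := by
    intro b hb
    by_contra hne
    push Not at hne
    have := hγ (Pi.single b 1) (by
        intro b' hb'
        by_cases hbb : b' = b
        · exact hbb ▸ hb
        · simp [hbb] at hb') (by
        intro c hc
        rw [colorForm_apply]
        refine coboundary_eq_zero_of_forall fun k hk => ?_
        rw [cochainMask_apply]
        split_ifs with hcol
        · by_contra h0
          have hkb : c.erase k = b := by
            by_contra hne
            exact h0 (by simp [hne])
          exact hne c hc (by rw [← hcol, id, hkb]) (hkb ▸ Finset.erase_subset _ _)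
        · rfl)
    have h1 := congrFun ((Submodule.mem_bot K).1 this) b
    simp at h1
  choose! g hg1 hg2 hg3 using hex
  refine ⟨g, id, fun b hb => ⟨hg1 b hb, hg3 b hb⟩, by simp, by simp, fun b hb b' hb' e => ?_⟩
  left
  rw [← hg2 b hb, ← hg2 b' hb', e]

end Levels

section Core

variable {K : Type*} [Field K] {n d : ℕ} {F B C : Finset (Finset (Fin n))}

/-- The faces in `B` lying above some face of `Q`. -/
def above (B Q : Finset (Finset (Fin n))) : Finset (Finset (Fin n)) :=
  B.filter fun b => ∃ f ∈ Q, f ⊆ b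

lemma mem_above {Q : Finset (Finset (Fin n))} {b : Finset (Fin n)} :
    b ∈ above B Q ↔ b ∈ B ∧ ∃ f ∈ Q, f ⊆ b := by simp [above]

lemma exists_subset_of_coboundary_ne_zero {a : Finset (Fin n) → K} {b : Finset (Fin n)}
    (h : coboundary K n a b ≠ 0) : ∃ f, a f ≠ 0 ∧ f ⊆ b := by
  obtain ⟨k, -, hk⟩ := exists_erase_of_coboundary_ne_zero h
  exact ⟨_, hk, Finset.erase_subset _ _⟩

lemma LevelData.coboundary_eq_zero (hL : LevelData K n d F B C) {a l : Finset (Fin n) → K}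
    (ha : ∀ f, a f ≠ 0 → f ∈ F) (hl : ∀ b ∈ B, l b = coboundary K n a b)
    (hl' : ∀ b ∉ B, l b = 0) {c : Finset (Fin n)} (hc : c ∈ C) : coboundary K n l c = 0 := by
  have h0 : coboundary K n (coboundary K n a) c = 0 := congrFun (koszulD_koszulD _ a) c
  rw [← h0]
  refine coboundary_congr fun k hk => ?_
  by_cases hb : c.erase k ∈ B
  · exact hl _ hb
  · rw [hl' _ hb]
    by_contra h
    obtain ⟨f, hf, hfb⟩ := exists_subset_of_coboundary_ne_zero (Ne.symm h)
    refine hb (hL.mem_mid c hc _ (Finset.erase_subset _ _) ?_ f (ha f hf) hfb)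
    rw [Finset.card_erase_of_mem hk, hL.cardC c hc]; rfl

/-- Splitting the rows according to disjoint sets of degree-`d` faces splits the columns. -/
lemma LevelData.exactOn_split (hL : LevelData K n d F B C)
    {Q₁ Q₂ R₁ R₂ D : Finset (Finset (Fin n))} (hDC : D ⊆ C) (hF₁ : Q₁ ⊆ F) (hF₂ : Q₂ ⊆ F)
    (hB₁ : R₁ ⊆ B) (hB₂ : R₂ ⊆ B) (hR : Disjoint R₁ R₂)
    (h₁ : above B Q₁ ⊆ R₁) (h₂ : above B Q₂ ⊆ R₂)
    (hex : ExactOn K B (Q₁ ∪ Q₂) (R₁ ∪ R₂) D) :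
    ∃ D₁ D₂, D₁ ⊆ D ∧ D₂ ⊆ D ∧ Disjoint D₁ D₂ ∧ ExactOn K B Q₁ R₁ D₁ ∧
      ExactOn K B Q₂ R₂ D₂ := by
  have hres : ∀ Q Q' R R' : Finset (Finset (Fin n)), above B Q ⊆ R → above B Q' ⊆ R' →
      Disjoint R R' → ∀ a : Finset (Fin n) → K, (∀ f, a f ≠ 0 → f ∈ Q ∨ f ∈ Q') → ∀ b ∈ B,
      (if b ∈ R then coboundary K n a b else 0) =
        coboundary K n (cochainMask (· ∈ Q) a) b := by
    intro Q Q' R R' hQ hQ' hRR a ha b hb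
    split_ifs with hbR
    · refine coboundary_congr fun k hk => ?_
      rw [cochainMask_apply]
      split_ifs with hkQ
      · rfl
      · by_contra h0
        have := (ha _ h0).resolve_left hkQ
        exact Finset.disjoint_left.1 hRR hbR
          (hQ' (mem_above.2 ⟨hb, _, this, Finset.erase_subset _ _⟩))
    · by_contra h0
      obtain ⟨f, hf, hfb⟩ := exists_subset_of_coboundary_ne_zero (Ne.symm h0)
      rw [cochainMask_apply] at hf
      have hfQ : f ∈ Q := by by_contra h; simp [h] at hf
      exact hbR (hQ (mem_above.2 ⟨hb, f, hfQ, hfb⟩))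
  have hmaskF : ∀ Q ⊆ F, ∀ (a : Finset (Fin n) → K) f, cochainMask (· ∈ Q) a f ≠ 0 → f ∈ F := by
    intro Q hQF a f hf
    refine hQF ?_
    by_contra h
    simp [cochainMask_apply, h] at hf
  let N : Submodule K (Finset (Fin n) → K) :=
    { carrier := {l | (∀ b, l b ≠ 0 → b ∈ R₁ ∪ R₂) ∧
        ∃ a ∈ supportedOn K (Q₁ ∪ Q₂), ∀ b ∈ B, l b = coboundary K n a b}
      zero_mem' := ⟨fun b h => (h rfl).elim, 0, Submodule.zero_mem _, fun b _ => by simp⟩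
      add_mem' := by
        rintro l l' ⟨hl, a, ha, hla⟩ ⟨hl', a', ha', hla'⟩
        exact ⟨(supportedOn K (R₁ ∪ R₂)).add_mem hl hl', a + a', Submodule.add_mem _ ha ha',
          fun b hb => by simp [hla b hb, hla' b hb]⟩
      smul_mem' := by
        rintro r l ⟨hl, a, ha, hla⟩
        exact ⟨(supportedOn K (R₁ ∪ R₂)).smul_mem r hl, r • a, Submodule.smul_mem _ r ha,
          fun b hb => by simp [hla b hb]⟩ }
  let col : Finset (Fin n) → Bool := fun b => decide (b ∈ R₁)
  obtain ⟨γ, hγ⟩ := exists_choice_of_sum_forms (colorForm (K := K) col) N D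
    (supportedOn K (R₁ ∪ R₂))
    (by
      rintro l ⟨hl, a, ha, hla⟩ c hc k
      have ha' : ∀ f, a f ≠ 0 → f ∈ Q₁ ∨ f ∈ Q₂ := fun f hf => Finset.mem_union.1 (ha f hf)
      rw [colorForm_apply]
      cases k
      · refine hL.coboundary_eq_zero (hmaskF Q₂ hF₂ a) (fun b hb => ?_) (fun b hb => ?_) (hDC hc)
        · rw [← hres Q₂ Q₁ R₂ R₁ h₂ h₁ hR.symm a (fun f hf => (ha' f hf).symm) b hb,
            cochainMask_apply]
          by_cases hb1 : b ∈ R₁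
          · have hb2 : b ∉ R₂ := Finset.disjoint_left.1 hR hb1
            simp [col, hb1, hb2]
          · by_cases hb2 : b ∈ R₂
            · simp [col, hb1, hb2, hla b hb]
            · have : l b = 0 := by
                by_contra h0
                simpa [hb1, hb2] using hl b h0
              simp [hb2, this]
        · rw [cochainMask_apply]
          have : l b = 0 := by
            by_contra h0
            exact hb ((Finset.union_subset hB₁ hB₂) (hl b h0))
          simp [this]
      · refine hL.coboundary_eq_zero (hmaskF Q₁ hF₁ a) (fun b hb => ?_) (fun b hb => ?_) (hDC hc)
        · rw [← hres Q₁ Q₂ R₁ R₂ h₁ h₂ hR a ha' b hb, cochainMask_apply]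
          simp [col, hla b hb]
        · rw [cochainMask_apply]
          have : l b = 0 := by
            by_contra h0
            exact hb ((Finset.union_subset hB₁ hB₂) (hl b h0))
          simp [this])
    (by
      intro l hl hD
      simp only [sum_colorForm] at hD
      obtain ⟨a, ha, hla⟩ := hex l hl hD
      exact ⟨hl, a, ha, hla⟩)
  refine ⟨D.filter fun c => γ c = true, D.filter fun c => ¬ γ c = true,
    Finset.filter_subset _ _, Finset.filter_subset _ _, Finset.disjoint_filter_filter_not _ _ _,
    ?_, ?_⟩
  · intro l hl hD
    obtain ⟨-, a, ha, hla⟩ := hγ l (fun b hb => Finset.mem_union_left _ (hl b hb)) (by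
      intro c hc
      rw [colorForm_apply]
      by_cases hcol : γ c = true
      · rw [← hD c (Finset.mem_filter.2 ⟨hc, hcol⟩)]
        refine coboundary_congr fun k hk => ?_
        rw [cochainMask_apply, hcol]
        by_cases h0 : l (c.erase k) = 0
        · simp [h0]
        · simp [col, hl _ h0]
      · refine coboundary_eq_zero_of_forall fun k hk => ?_
        rw [cochainMask_apply]
        by_cases h0 : l (c.erase k) = 0
        · simp [h0]
        · simp [col, hl _ h0, hcol])
    refine ⟨cochainMask (· ∈ Q₁) a, fun f hf => ?_, fun b hb => ?_⟩
    · by_contra h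
      simp [cochainMask_apply, h] at hf
    · rw [← hres Q₁ Q₂ R₁ R₂ h₁ h₂ hR a (fun f hf => Finset.mem_union.1 (ha f hf)) b hb]
      split_ifs with hbR
      · exact hla b hb
      · by_contra h0
        exact hbR (hl b h0)
  · intro l hl hD
    have hl1 : ∀ b, l b ≠ 0 → b ∉ R₁ := fun b hb hb1 => Finset.disjoint_left.1 hR hb1 (hl b hb)
    obtain ⟨-, a, ha, hla⟩ := hγ l (fun b hb => Finset.mem_union_right _ (hl b hb)) (by
      intro c hc
      rw [colorForm_apply]
      by_cases hcol : γ c = true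
      · refine coboundary_eq_zero_of_forall fun k hk => ?_
        rw [cochainMask_apply]
        by_cases h0 : l (c.erase k) = 0
        · simp [h0]
        · simp [col, hl1 _ h0, hcol]
      · rw [← hD c (Finset.mem_filter.2 ⟨hc, hcol⟩)]
        refine coboundary_congr fun k hk => ?_
        rw [Bool.not_eq_true] at hcol
        rw [cochainMask_apply, hcol]
        by_cases h0 : l (c.erase k) = 0
        · simp [h0]
        · simp [col, hl1 _ h0])
    refine ⟨cochainMask (· ∈ Q₂) a, fun f hf => ?_, fun b hb => ?_⟩
    · by_contra h
      simp [cochainMask_apply, h] at hf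
    · rw [← hres Q₂ Q₁ R₂ R₁ h₂ h₁ hR.symm a (fun f hf => (Finset.mem_union.1 (ha f hf)).symm) b hb]
      split_ifs with hbR
      · exact hla b hb
      · by_contra h0
        exact hbR (hl b h0)

lemma LevelData.exists_mem_not_mem (hL : LevelData K n d F B C) {f : Finset (Fin n)}
    (hf : f ∈ F) {p : Fin n} (hp : p ∉ f) : ∃ b ∈ B, f ⊆ b ∧ p ∉ b := by
  by_contra h
  push Not at h
  have := hL.eq_zero p (Pi.single f 1) (fun f' hf' => by
      have : f' = f := by by_contra h0; exact hf' (Pi.single_eq_of_ne h0 _)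
      subst this; exact ⟨hf, hp⟩)
    (fun b hb hpb => by
      by_contra h0
      obtain ⟨f', hf', hfb⟩ := exists_subset_of_coboundary_ne_zero h0
      have : f' = f := by by_contra h0; exact hf' (Pi.single_eq_of_ne h0 _)
      subst this
      exact hpb (h b hb hfb))
  have := congrFun this f
  simp at this

lemma LevelData.exists_above (hL : LevelData K n d F B C) {f : Finset (Fin n)}
    (hf : f ∈ F) : ∃ b ∈ B, f ⊆ b := by
  obtain ⟨p, hp⟩ : ∃ p, p ∉ f := by
    by_contra h
    push Not at h
    have := hL.cardF f hf
    rw [Finset.eq_univ_iff_forall.2 h, Finset.card_univ, Fintype.card_fin] at this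
    exact (this ▸ hL.lt).false
  obtain ⟨b, hb, h, -⟩ := hL.exists_mem_not_mem hf hp
  exact ⟨b, hb, h⟩

lemma LevelData.exists_above_ne (hL : LevelData K n d F B C) {f : Finset (Fin n)}
    (hf : f ∈ F) {b : Finset (Fin n)} (hb : b.card = d + 1) (hfb : f ⊆ b) :
    ∃ b' ∈ B, f ⊆ b' ∧ b' ≠ b := by
  obtain ⟨p, hpb, hpf, -⟩ := exists_eq_erase hfb (by rw [hb, hL.cardF f hf])
  obtain ⟨b', hb', h, hp⟩ := hL.exists_mem_not_mem hf hpf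
  exact ⟨b', hb', h, fun e => hp (e ▸ hpb)⟩

/-- The faces of `B` between `f` and `c`. -/
def between (B : Finset (Finset (Fin n))) (f c : Finset (Fin n)) : Finset (Finset (Fin n)) :=
  B.filter fun b => f ⊆ b ∧ b ⊆ c

lemma mem_between {b f c : Finset (Fin n)} : b ∈ between B f c ↔ b ∈ B ∧ f ⊆ b ∧ b ⊆ c := by
  simp [between]

lemma LevelData.matchable_between (hL : LevelData K n d F B C) {f c : Finset (Fin n)}
    (hf : f ∈ F) (hc : c ∈ C) (hfc : f ⊆ c) : Matchable d {f} (between B f c) {c} := by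
  refine ⟨fun _ => c, fun _ => c, fun b hb => ⟨by simp, (mem_between.1 hb).2.2⟩, ?_, ?_, ?_⟩
  · intro f' hf'
    rw [Finset.mem_singleton] at hf'
    subst hf'
    exact ⟨by simp, hfc, fun b hb h1 h2 =>
      ⟨mem_between.2 ⟨hL.mem_mid c hc b h2 hb _ hf h1, h1, h2⟩, rfl⟩⟩
  · intro f' hf' f'' hf'' _
    rw [Finset.mem_singleton] at hf' hf''
    rw [hf', hf'']
  · intro b hb b' hb' _
    exact Or.inr ⟨f, by simp, (mem_between.1 hb).2.1, (mem_between.1 hb').2.1, rfl⟩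

/-- Adding an interval `[f, c]` to a matchable system. -/
lemma LevelData.matchable_insert (hL : LevelData K n d F B C) {Q D : Finset (Finset (Fin n))}
    {f c : Finset (Fin n)} (hQF : Q ⊆ F) (hfQ : f ∈ Q) (hDC : D ⊆ C) (hc : c ∈ D) (hfc : f ⊆ c)
    (h : Matchable d (Q.erase f) (above B Q \ between B f c) (D.erase c)) :
    Matchable d Q (above B Q) D := by
  have := h.union (D := D) (hL.matchable_between (hQF hfQ) (hDC hc) hfc) (by simp)
    Finset.sdiff_disjoint (by simp) (Finset.erase_subset _ _) (by simpa using hc)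
  rw [Finset.sdiff_union_of_subset, Finset.union_comm, ← Finset.insert_eq,
    Finset.insert_erase hfQ] at this
  · exact this
  · intro b hb
    obtain ⟨h1, h2, h3⟩ := mem_between.1 hb
    exact mem_above.2 ⟨h1, f, hfQ, h2⟩

lemma coboundary_eq_zero_of_rows {R : Finset (Finset (Fin n))} {l : Finset (Fin n) → K}
    (hl : ∀ b, l b ≠ 0 → b ∈ R) {c : Finset (Fin n)} (h : ∀ b ∈ R, ¬ b ⊆ c) :
    coboundary K n l c = 0 := by
  by_contra h0
  obtain ⟨b, hb, hbc⟩ := exists_subset_of_coboundary_ne_zero h0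
  exact h b (hl b hb) hbc

lemma LevelData.matchable_singleton (hL : LevelData K n d F B C) {f : Finset (Fin n)}
    (hf : f ∈ F) {D : Finset (Finset (Fin n))} (hDC : D ⊆ C)
    (hex : ExactOn K B {f} (above B {f}) D) : Matchable d {f} (above B {f}) D := by
  obtain ⟨b₀, hb₀, hfb₀⟩ := hL.exists_above hf
  obtain ⟨b₁, hb₁, hfb₁, hne⟩ := hL.exists_above_ne hf (hL.cardB b₀ hb₀) hfb₀
  have hsub : above B {f} ⊆ B := Finset.filter_subset _ _
  have hval : ∀ b ∈ B, f ⊆ b → ∀ a : Finset (Fin n) → K, (∀ f', a f' ≠ 0 → f' ∈ ({f} : Finset _)) →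
      coboundary K n a b = 0 → a = 0 := by
    intro b hb hfb a ha h0
    obtain ⟨p, hpb, hpf, rfl⟩ := exists_eq_erase hfb (by rw [hL.cardB b hb, hL.cardF f hf])
    rw [coboundary_eq_of_forall_ne hpb] at h0
    · have := (mul_eq_zero.1 h0).resolve_left (ksign_ne_zero _ _)
      ext f'
      by_contra h
      have h' := ha f' h
      rw [Finset.mem_singleton] at h'
      rw [h', this] at h
      exact h rfl
    · intro k hk hkp
      by_contra h
      have h' := ha _ h
      rw [Finset.mem_singleton] at h'
      have : k ∈ b.erase k := by rw [h']; exact Finset.mem_erase.2 ⟨hkp, hk⟩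
      simp at this
  have hex₀ : ∀ l : Finset (Fin n) → K, (∀ b, l b ≠ 0 → b ∈ above B {f}) → l b₀ = 0 →
      (∀ c ∈ D, coboundary K n l c = 0) → l = 0 := by
    intro l hl hl0 hD
    obtain ⟨a, ha, hla⟩ := hex l hl hD
    have := hval b₀ hb₀ hfb₀ a ha (by rw [← hla b₀ hb₀, hl0])
    ext b
    by_contra hb
    exact hb (by rw [hla b (hsub (hl b hb)), this, map_zero])
  obtain ⟨c, hc, hbc⟩ : ∃ c ∈ D, b₀ ⊆ c := by
    by_contra hno
    push Not at hno
    let l : Finset (Fin n) → K := fun b =>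
      if b ∈ B then coboundary K n (Pi.single f 1) b else 0
    have hsupp : ∀ f', (Pi.single f 1 : Finset (Fin n) → K) f' ≠ 0 → f' = f := fun f' hf' => by
      by_contra h0; exact hf' (Pi.single_eq_of_ne h0 _)
    have hl0 := hex₀ (fun b => if b = b₀ then 0 else l b) (fun b hb => by
        have h1 : l b ≠ 0 := by
          intro h; simp [h] at hb
        have hB : b ∈ B := by
          by_contra h; simp [l, h] at h1
        simp only [l, if_pos hB] at h1
        obtain ⟨f', hf', hfb⟩ := exists_subset_of_coboundary_ne_zero h1
        exact mem_above.2 ⟨hB, f, by simp, hsupp f' hf' ▸ hfb⟩) (by simp) (by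
        intro c hc
        rw [← hL.coboundary_eq_zero (a := Pi.single f 1) (l := l) (fun f' hf' => hsupp f' hf' ▸ hf)
          (fun b hb => by simp [l, hb]) (fun b hb => by simp [l, hb]) (hDC hc)]
        refine coboundary_congr fun k hk => ?_
        rw [if_neg]
        rintro rfl
        exact hno c hc (Finset.erase_subset _ _))
    have h1 := congrFun hl0 b₁
    simp only [if_neg hne, l, if_pos hb₁, Pi.zero_apply] at h1
    have h2 := congrFun (hval b₁ hb₁ hfb₁ _ (fun f' hf' => by simpa using hsupp f' hf') h1) f
    simp at h2
  have hfc : f ⊆ c := hfb₀.trans hbc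
  refine hL.matchable_insert (by simpa using hf) (by simp) hDC hc hfc ?_
  rw [Finset.erase_singleton]
  refine ExactOn.matchable (K := K) (Finset.sdiff_subset.trans hsub) fun l hl hD => ?_
  have hl' : ∀ b, l b ≠ 0 → b ∈ above B {f} := fun b hb => (Finset.mem_sdiff.1 (hl b hb)).1
  have : l = 0 := by
    refine hex₀ l hl' ?_ fun c' hc' => ?_
    · by_contra h0
      exact (Finset.mem_sdiff.1 (hl b₀ h0)).2 (mem_between.2 ⟨hb₀, hfb₀, hbc⟩)
    · by_cases hcc : c' = c
      · subst hcc
        refine coboundary_eq_zero_of_rows hl fun b hb hbc' => ?_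
        obtain ⟨h1, h2⟩ := Finset.mem_sdiff.1 hb
        obtain ⟨h3, f', hf', h4⟩ := mem_above.1 h1
        rw [Finset.mem_singleton] at hf'
        exact h2 (mem_between.2 ⟨h3, hf' ▸ h4, hbc'⟩)
      · exact hD c' (Finset.mem_erase.2 ⟨hcc, hc'⟩)
  exact ⟨0, by simp, fun b _ => by simp [this]⟩

end Core

section Induction

variable {K : Type*} [Field K] {n d : ℕ} {F B C : Finset (Finset (Fin n))}

/-- If a column contains a single face of `Q`, that face and column can be removed. -/
lemma LevelData.exactOn_erase (hL : LevelData K n d F B C) {Q D : Finset (Finset (Fin n))}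
    (hQF : Q ⊆ F) (hDC : D ⊆ C) (hex : ExactOn K B Q (above B Q) D) {f c : Finset (Fin n)}
    (hf : f ∈ Q) (hc : c ∈ D) (hfc : f ⊆ c) (huniq : ∀ f' ∈ Q, f' ⊆ c → f' = f) :
    ExactOn K B (Q.erase f) (above B Q \ between B f c) (D.erase c) := by
  intro l hl hD
  obtain ⟨a, ha, hla⟩ := hex l (fun b hb => (Finset.mem_sdiff.1 (hl b hb)).1) (fun c' hc' => by
    by_cases hcc : c' = c
    · subst hcc
      refine coboundary_eq_zero_of_rows hl fun b hb hbc' => ?_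
      obtain ⟨h1, h2⟩ := Finset.mem_sdiff.1 hb
      obtain ⟨h3, f', hf', h4⟩ := mem_above.1 h1
      rw [huniq f' hf' (h4.trans hbc')] at h4
      exact h2 (mem_between.2 ⟨h3, h4, hbc'⟩)
    · exact hD c' (Finset.mem_erase.2 ⟨hcc, hc'⟩))
  refine ⟨a, fun f' hf' => Finset.mem_erase.2 ⟨?_, ha f' hf'⟩, hla⟩
  rintro rfl
  have hcf := hL.cardF f' (hQF hf)
  obtain ⟨p, hpc, hpf⟩ : ∃ p ∈ c, p ∉ f' := by
    by_contra h
    push Not at h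
    have := Finset.card_le_card (show c ⊆ f' from h)
    rw [hL.cardC c (hDC hc), hcf] at this
    omega
  have hbc : insert p f' ⊆ c := Finset.insert_subset hpc hfc
  have hbB : insert p f' ∈ B := hL.mem_mid c (hDC hc) _ hbc
    (by rw [Finset.card_insert_of_notMem hpf, hcf]) f' (hQF hf) (Finset.subset_insert _ _)
  have hl0 : l (insert p f') = 0 := by
    by_contra h
    exact (Finset.mem_sdiff.1 (hl _ h)).2 (mem_between.2 ⟨hbB, Finset.subset_insert _ _, hbc⟩)
  rw [hla _ hbB, coboundary_eq_of_forall_ne (Finset.mem_insert_self p f'),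
    Finset.erase_insert hpf] at hl0
  · exact hf' ((mul_eq_zero.1 hl0).resolve_left (ksign_ne_zero _ _))
  · intro k hk hkp
    by_contra h
    have := huniq _ (ha _ h) ((Finset.erase_subset _ _).trans hbc)
    have h2 : k ∈ (insert p f').erase k := by
      rw [this]; exact (Finset.mem_insert.1 hk).resolve_left hkp
    simp at h2

/-- Coning a cochain on `Q` that is closed on the relevant columns with a new vertex `p`. -/
lemma LevelData.insert_not_mem (hL : LevelData K n d F B C) {Q D : Finset (Finset (Fin n))}
    (hQF : Q ⊆ F) (hDC : D ⊆ C) (hex : ExactOn K B Q (above B Q) D) {p : Fin n}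
    (hp : ∀ f ∈ Q, p ∉ f) (a : Finset (Fin n) → K) (ha : ∀ f, a f ≠ 0 → f ∈ Q)
    (hz : ∀ c ∈ D, p ∈ c → (∃ f ∈ Q, f ⊆ c) → coboundary K n a (c.erase p) = 0)
    {f : Finset (Fin n)} (hf : a f ≠ 0) : insert p f ∉ B := by
  intro hB
  let l : Finset (Fin n) → K := fun b =>
    if b ∈ B ∧ p ∈ b then ksign K p b * a (b.erase p) else 0
  have hlmem : ∀ b, l b ≠ 0 → b ∈ B ∧ a (b.erase p) ≠ 0 := by
    intro b hb
    by_cases h : b ∈ B ∧ p ∈ b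
    · simp only [l, if_pos h] at hb
      exact ⟨h.1, right_ne_zero_of_mul hb⟩
    · simp [l, h] at hb
  obtain ⟨a', ha', hla'⟩ := hex l (fun b hb => by
      obtain ⟨h1, h2⟩ := hlmem b hb
      exact mem_above.2 ⟨h1, _, ha _ h2, Finset.erase_subset _ _⟩) (fun c hc => by
      by_cases hpc : p ∈ c
      · have hval : ∀ k ∈ c, k ≠ p →
            l (c.erase k) = ksign K p (c.erase k) * a ((c.erase k).erase p) := by
          intro k hk hkp
          by_cases hB' : c.erase k ∈ B
          · simp only [l, hB', Finset.mem_erase, hpc, ne_eq, hkp.symm, not_false_eq_true, and_self,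
              if_true]
          · have h0 : a ((c.erase k).erase p) = 0 := by
              by_contra h0
              refine hB' (hL.mem_mid c (hDC hc) _ (Finset.erase_subset _ _) ?_ _ (hQF (ha _ h0))
                (Finset.erase_subset _ _))
              rw [Finset.card_erase_of_mem hk, hL.cardC c (hDC hc)]; rfl
            simp [l, hB', h0]
        have h1 : coboundary K n l c = -(ksign K p c * coboundary K n a (c.erase p)) := by
          rw [coboundary_apply, coboundary_apply, ← Finset.add_sum_erase _ _ hpc]
          have : l (c.erase p) = 0 := by simp [l]
          rw [this, mul_zero, zero_add, Finset.mul_sum, ← Finset.sum_neg_distrib]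
          refine Finset.sum_congr rfl fun k hk => ?_
          obtain ⟨hkp, hkc⟩ := Finset.mem_erase.1 hk
          rw [hval k hkc hkp, Finset.erase_right_comm (a := k)]
          have hs := ksign_swap (R := K) hpc hkc hkp.symm
          linear_combination a ((c.erase p).erase k) * hs
        rw [h1, neg_eq_zero]
        by_cases hfc : ∃ f ∈ Q, f ⊆ c
        · rw [hz c hc hpc hfc, mul_zero]
        · have : coboundary K n a (c.erase p) = 0 := by
            by_contra h0
            obtain ⟨f', hf', hfc'⟩ := exists_subset_of_coboundary_ne_zero h0
            exact hfc ⟨f', ha f' hf', hfc'.trans (Finset.erase_subset _ _)⟩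
          rw [this, mul_zero]
      · refine coboundary_eq_zero_of_forall fun k _ => ?_
        simp [l, hpc])
  have h0 := hL.eq_zero p a' (fun f hf => ⟨hQF (ha' f hf), hp f (ha' f hf)⟩) (fun b hb hpb => by
    rw [← hla' b hb]; simp [l, hpb])
  have h1 := hla' _ hB
  rw [h0, map_zero, Pi.zero_apply] at h1
  simp only [l, hB, Finset.mem_insert_self, and_self, if_true,
    Finset.erase_insert (hp f (ha f hf))] at h1
  exact hf ((mul_eq_zero.1 h1).resolve_left (ksign_ne_zero _ _))

/-- The coefficient ratio for which a cochain on two facets of `w` is closed on `w`. -/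
lemma exists_ratio {f₁ f₂ w : Finset (Fin n)} (h₁ : f₁ ⊆ w) (h₂ : f₂ ⊆ w) (hne : f₁ ≠ f₂)
    (hc₁ : w.card = f₁.card + 1) (hc₂ : w.card = f₂.card + 1) :
    ∃ r : K, r ≠ 0 ∧ ∀ a : Finset (Fin n) → K, (∀ f, a f ≠ 0 → f ⊆ w → f = f₁ ∨ f = f₂) →
      a f₂ = r * a f₁ → coboundary K n a w = 0 := by
  obtain ⟨x, hx, -, rfl⟩ := exists_eq_erase h₁ hc₁
  obtain ⟨y, hy, -, rfl⟩ := exists_eq_erase h₂ hc₂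
  have hxy : x ≠ y := fun h => hne (h ▸ rfl)
  have hinj : ∀ k ∈ w, ∀ z ∈ w, w.erase k = w.erase z → k = z := fun k hk z hz h =>
    Finset.erase_injOn w hk hz h
  refine ⟨-(ksign K x w * ksign K y w), neg_ne_zero.2 (mul_ne_zero (ksign_ne_zero _ _)
    (ksign_ne_zero _ _)), fun a ha hr => ?_⟩
  rw [coboundary_apply, ← Finset.sum_subset (s₁ := {x, y}), Finset.sum_pair hxy, hr]
  · linear_combination (-ksign K x w * a (w.erase x)) * ksign_mul_self (R := K) y w
  · intro k hk
    simp only [Finset.mem_insert, Finset.mem_singleton] at hk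
    rcases hk with rfl | rfl <;> assumption
  · intro k hk hk'
    simp only [Finset.mem_insert, Finset.mem_singleton, not_or] at hk'
    have : a (w.erase k) = 0 := by
      by_contra h
      rcases ha _ h (Finset.erase_subset _ _) with h' | h'
      · exact hk'.1 (hinj k hk x hx h')
      · exact hk'.2 (hinj k hk y hy h')
    rw [this, mul_zero]

lemma union_eq_of_subset {f₁ f₂ w : Finset (Fin n)} (hf₁ : f₁.card = d) (hf₂ : f₂.card = d)
    (hw : w.card = d + 1) (hne : f₁ ≠ f₂) (h₁ : f₁ ⊆ w) (h₂ : f₂ ⊆ w) : f₁ ∪ f₂ = w := by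
  refine Finset.eq_of_subset_of_card_le (Finset.union_subset h₁ h₂) ?_
  rw [hw]
  by_contra h
  have h3 : (f₁ ∪ f₂).card ≤ d := by omega
  have e1 := Finset.eq_of_subset_of_card_le (Finset.subset_union_left (s₁ := f₁) (s₂ := f₂))
    (by omega)
  have e2 := Finset.eq_of_subset_of_card_le (Finset.subset_union_right (s₁ := f₁) (s₂ := f₂))
    (by omega)
  exact hne (e1.trans e2.symm)

/-- There is no exact system in which every column meeting `Q` meets it twice and all of `Q` lies
in a single face of `B`. -/
lemma LevelData.false_of_subset_union (hL : LevelData K n d F B C)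
    {Q D : Finset (Finset (Fin n))} (hQF : Q ⊆ F) (hDC : D ⊆ C)
    (hex : ExactOn K B Q (above B Q) D)
    (hD : ∀ c ∈ D, ∀ f ∈ Q, f ⊆ c → ∃ f' ∈ Q, f' ≠ f ∧ f' ⊆ c)
    {f₁ f₂ : Finset (Fin n)} (hf₁ : f₁ ∈ Q) (hf₂ : f₂ ∈ Q) (hne : f₁ ≠ f₂)
    (hw : f₁ ∪ f₂ ∈ B) (hsub : ∀ f ∈ Q, f ⊆ f₁ ∪ f₂) : False := by
  have hcF := fun f hf => hL.cardF f (hQF hf)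
  have hcw := hL.cardB _ hw
  obtain ⟨b, hb, hfb, hbw⟩ := hL.exists_above_ne (hQF hf₁) hcw Finset.subset_union_left
  obtain ⟨p, hpb, hpf, hfe⟩ := exists_eq_erase hfb (by rw [hL.cardB b hb, hcF _ hf₁])
  have hbe : b = insert p f₁ := by rw [hfe, Finset.insert_erase hpb]
  have hpw : p ∉ f₁ ∪ f₂ := by
    intro h
    refine hbw (Finset.eq_of_subset_of_card_le ?_ (by rw [hL.cardB b hb, hcw]))
    rw [hbe]
    exact Finset.insert_subset h Finset.subset_union_left
  obtain ⟨r, hr, hra⟩ := exists_ratio (K := K) (w := f₁ ∪ f₂) Finset.subset_union_left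
    Finset.subset_union_right hne (by rw [hcw, hcF _ hf₁]) (by rw [hcw, hcF _ hf₂])
  let a : Finset (Fin n) → K := fun f => if f = f₁ then 1 else if f = f₂ then r else 0
  have ha : ∀ f, a f ≠ 0 → f = f₁ ∨ f = f₂ := by
    intro f hf
    by_contra h
    rw [not_or] at h
    simp [a, h.1, h.2] at hf
  refine hL.insert_not_mem hQF hDC hex (p := p) (fun f hf h => hpw (hsub f hf h)) a
    (fun f hf => (ha f hf).elim (· ▸ hf₁) (· ▸ hf₂)) ?_ (f := f₁) (by simp [a]) (hbe ▸ hb)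
  rintro c hc hpc ⟨f, hf, hfc⟩
  obtain ⟨f', hf', hff', hfc'⟩ := hD c hc f hf hfc
  have hwc : f₁ ∪ f₂ ⊆ c.erase p := by
    rw [← union_eq_of_subset (hcF f hf) (hcF f' hf') hcw hff'.symm (hsub f hf) (hsub f' hf')]
    exact Finset.subset_erase.2 ⟨Finset.union_subset hfc hfc', fun h =>
      (Finset.mem_union.1 h).elim (fun h => hpw (hsub f hf h)) (fun h => hpw (hsub f' hf' h))⟩
  have : f₁ ∪ f₂ = c.erase p := by
    refine Finset.eq_of_subset_of_card_le hwc ?_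
    rw [Finset.card_erase_of_mem hpc, hL.cardC c (hDC hc), hcw]; rfl
  rw [← this]
  exact hra a (fun f hf _ => ha f hf) (by simp [a, hne.symm])

/-- The analogue of the previous lemma for three faces, two of which overlap the first one in
different faces of `B`. -/
lemma LevelData.false_of_triple (hL : LevelData K n d F B C)
    {Q D : Finset (Finset (Fin n))} (hQF : Q ⊆ F) (hDC : D ⊆ C)
    (hex : ExactOn K B Q (above B Q) D)
    (hD : ∀ c ∈ D, ∀ f ∈ Q, f ⊆ c → ∃ f' ∈ Q, f' ≠ f ∧ f' ⊆ c)
    {f₁ f₂ f₃ : Finset (Fin n)} (hQ : ∀ f, f ∈ Q ↔ f = f₁ ∨ f = f₂ ∨ f = f₃) (h₁₂ : f₁ ≠ f₂)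
    (h₁₃ : f₁ ≠ f₃) (hw : f₁ ∪ f₂ ∈ B) (hw' : f₁ ∪ f₃ ∈ B) (hsub : ¬ f₃ ⊆ f₁ ∪ f₂) : False := by
  have hf₁ : f₁ ∈ Q := (hQ _).2 (Or.inl rfl)
  have hf₂ : f₂ ∈ Q := (hQ _).2 (Or.inr (Or.inl rfl))
  have hf₃ : f₃ ∈ Q := (hQ _).2 (Or.inr (Or.inr rfl))
  have hcF := fun f hf => hL.cardF f (hQF hf)
  have hcw := hL.cardB _ hw
  have hcw' := hL.cardB _ hw'
  have h₂₃ : f₂ ≠ f₃ := fun h => hsub (h ▸ Finset.subset_union_right)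
  obtain ⟨z, hzw', hzf₁, hze⟩ := exists_eq_erase (Finset.subset_union_left (s₁ := f₁) (s₂ := f₃))
    (by rw [hcw', hcF _ hf₁])
  have hw'e : f₁ ∪ f₃ = insert z f₁ := by
    conv_rhs => rw [hze]
    rw [Finset.insert_erase hzw']
  have hz : z ∉ f₁ ∪ f₂ := by
    intro h
    refine hsub (Finset.subset_union_right.trans (?_ : f₁ ∪ f₃ ⊆ _))
    rw [hw'e]
    exact Finset.insert_subset h Finset.subset_union_left
  have hzf₃ : z ∈ f₃ := (Finset.mem_union.1 hzw').resolve_left hzf₁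
  have hzf₂ : z ∉ f₂ := fun h => hz (Finset.mem_union_right _ h)
  -- the face `u = f₁ ∪ f₂ ∪ f₃`
  set u := insert z (f₁ ∪ f₂) with hu
  have hcu : u.card = d + 2 := by rw [hu, Finset.card_insert_of_notMem hz, hcw]
  have hw'u : f₁ ∪ f₃ ⊆ u := by
    rw [hw'e]
    exact Finset.insert_subset_insert _ Finset.subset_union_left
  have hQu : ∀ f ∈ Q, f ⊆ u := by
    intro f hf
    rcases (hQ f).1 hf with rfl | rfl | rfl
    · exact Finset.subset_union_left.trans (Finset.subset_insert _ _)
    · exact Finset.subset_union_right.trans (Finset.subset_insert _ _)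
    · exact Finset.subset_union_right.trans hw'u
  obtain ⟨x, hxu, hx, hxe⟩ := exists_eq_erase hw'u (by rw [hcu, hcw'])
  obtain ⟨r, hr, hra⟩ := exists_ratio (K := K) (w := f₁ ∪ f₂) Finset.subset_union_left
    Finset.subset_union_right h₁₂ (by rw [hcw, hcF _ hf₁]) (by rw [hcw, hcF _ hf₂])
  obtain ⟨s, hs, hsa⟩ := exists_ratio (K := K) (w := f₁ ∪ f₃) Finset.subset_union_left
    Finset.subset_union_right h₁₃ (by rw [hcw', hcF _ hf₁]) (by rw [hcw', hcF _ hf₃])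
  let a : Finset (Fin n) → K := fun f =>
    if f = f₁ then 1 else if f = f₂ then r else if f = f₃ then s else 0
  have ha : ∀ f, a f ≠ 0 → f = f₁ ∨ f = f₂ ∨ f = f₃ := by
    intro f hf
    by_contra h
    rw [not_or, not_or] at h
    simp [a, h.1, h.2.1, h.2.2] at hf
  have haQ : ∀ f ∈ Q, a f ≠ 0 := by
    intro f hf
    rcases (hQ f).1 hf with rfl | rfl | rfl
    · simp [a]
    · simp [a, h₁₂.symm, hr]
    · simp [a, h₁₃.symm, h₂₃.symm, hs]
  have hf₂w' : ¬ f₂ ⊆ f₁ ∪ f₃ := by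
    intro h
    have := union_eq_of_subset (hcF _ hf₁) (hcF _ hf₂) hcw' h₁₂ Finset.subset_union_left h
    exact hsub (this ▸ Finset.subset_union_right)
  have haw : coboundary K n a (f₁ ∪ f₂) = 0 := hra a (fun f hf hfw => by
    rcases ha f hf with rfl | rfl | rfl
    · exact Or.inl rfl
    · exact Or.inr rfl
    · exact (hsub hfw).elim) (by simp [a, h₁₂.symm])
  have haw' : coboundary K n a (f₁ ∪ f₃) = 0 := hsa a (fun f hf hfw => by
    rcases ha f hf with rfl | rfl | rfl
    · exact Or.inl rfl
    · exact (hf₂w' hfw).elim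
    · exact Or.inr rfl) (by simp [a, h₁₃.symm, h₂₃.symm])
  have huz : u.erase z = f₁ ∪ f₂ := by rw [hu, Finset.erase_insert hz]
  have hxz : x ≠ z := fun h => hx (h ▸ hzw')
  have hxf₂ : x ∈ f₂ := by
    have : x ∈ f₁ ∪ f₂ := (Finset.mem_insert.1 hxu).resolve_left hxz
    exact (Finset.mem_union.1 this).resolve_left fun h => hx (Finset.mem_union_left _ h)
  -- facets of `u` containing `f₁`
  have hfacet : ∀ k ∈ u, f₁ ⊆ u.erase k → coboundary K n a (u.erase k) = 0 := by
    intro k hk hfk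
    have hkf : k ∉ f₁ := fun h => by simpa using hfk h
    have : k = x ∨ k = z := by
      by_contra h
      rw [not_or] at h
      have h1 : k ∈ f₁ ∪ f₂ := (Finset.mem_insert.1 hk).resolve_left h.2
      have h2 : insert x f₁ = f₁ ∪ f₂ := by
        refine Finset.eq_of_subset_of_card_le (Finset.insert_subset
          (Finset.mem_union_right _ hxf₂) Finset.subset_union_left) ?_
        rw [Finset.card_insert_of_notMem fun h => hx (Finset.mem_union_left _ h), hcw,
          hcF _ hf₁]
      rw [← h2] at h1
      exact hkf ((Finset.mem_insert.1 h1).resolve_left h.1)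
    rcases this with rfl | rfl
    · rw [← hxe, haw']
    · rw [huz, haw]
  have hpair : ∀ e ⊆ u, e.card = d + 1 → ∀ f ∈ Q, ∀ f' ∈ Q, f' ≠ f → f ⊆ e → f' ⊆ e →
      coboundary K n a e = 0 := by
    intro e heu hce f hf f' hf' hff' hfe hfe'
    obtain ⟨k, hku, hke, rfl⟩ := exists_eq_erase heu (by rw [hcu, hce])
    by_cases hf₁k : f₁ ⊆ u.erase k
    · exact hfacet k hku hf₁k
    have h23 : f₂ ⊆ u.erase k ∧ f₃ ⊆ u.erase k := by
      rcases (hQ f).1 hf with rfl | rfl | rfl <;> rcases (hQ f').1 hf' with rfl | rfl | rfl <;>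
        first
        | exact (hff' rfl).elim
        | exact (hf₁k ‹_›).elim
        | exact ⟨‹_›, ‹_›⟩
    have hkf₁ : k ∈ f₁ := by
      by_contra h
      exact hf₁k (Finset.subset_erase.2 ⟨hQu _ hf₁, h⟩)
    have hkk : ∀ g : Finset (Fin n), k ∉ g → ∀ k', k' ∉ g → k ≠ k' → ∀ v, v ∉ g → v ∈ u → k ∈ u →
        k' ∈ u → g ⊆ u → g.card = d → v = k ∨ v = k' := by
      intro g hk k' hk' hne v hv hvu hku hk'u hgu hcg
      have h2 : (u \ g).card = 2 := by rw [Finset.card_sdiff_of_subset hgu]; omega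
      by_contra h
      rw [not_or] at h
      have h3 : ({k, k', v} : Finset (Fin n)) ⊆ u \ g := by
        intro i hi
        simp only [Finset.mem_insert, Finset.mem_singleton] at hi
        rw [Finset.mem_sdiff]
        rcases hi with rfl | rfl | rfl <;> exact ⟨‹_›, ‹_›⟩
      have h4 : ({k, k', v} : Finset (Fin n)).card = 3 :=
        Finset.card_eq_three.2 ⟨k, k', v, hne, Ne.symm h.1, Ne.symm h.2, rfl⟩
      have := Finset.card_le_card h3
      omega
    have hzero : coboundary K n (coboundary K n a) u = 0 := congrFun (koszulD_koszulD _ a) u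
    rw [coboundary_eq_of_forall_ne hku] at hzero
    · exact (mul_eq_zero.1 hzero).resolve_left (ksign_ne_zero _ _)
    · intro k' hk' hne
      by_contra h0
      obtain ⟨g, hg, hgk⟩ := exists_subset_of_coboundary_ne_zero h0
      have hk'g : k' ∉ g := fun h => by simpa using hgk h
      rcases ha g hg with rfl | rfl | rfl
      · exact h0 (hfacet k' hk' hgk)
      · rcases hkk g (fun h => by simpa using h23.1 h) k' hk'g hne.symm z hzf₂
          (Finset.mem_insert_self _ _) hku hk' (hQu _ hf₂) (hcF _ hf₂) with rfl | rfl
        · exact hzf₁ hkf₁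
        · exact h0 (by rw [huz, haw])
      · rcases hkk g (fun h => by simpa using h23.2 h) k' hk'g hne.symm x
          (fun h => hx (Finset.mem_union_right _ h)) hxu hku hk' (hQu _ hf₃) (hcF _ hf₃)
          with rfl | rfl
        · exact hx (Finset.mem_union_left _ hkf₁)
        · exact h0 (by rw [← hxe, haw'])
  have houtside : ∀ p ∉ u, ∀ f ∈ Q, insert p f ∉ B := by
    intro p hp f hf
    refine hL.insert_not_mem hQF hDC hex (p := p) (fun f hf h => hp (hQu f hf h)) a
      (fun f hf => (hQ f).2 (ha f hf)) ?_ (haQ f hf)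
    rintro c hc hpc ⟨g, hg, hgc⟩
    obtain ⟨g', hg', hgg', hgc'⟩ := hD c hc g hg hgc
    have hsubc : g ∪ g' ⊆ c.erase p := Finset.subset_erase.2 ⟨Finset.union_subset hgc hgc',
      fun h => (Finset.mem_union.1 h).elim (fun h => hp (hQu g hg h))
        (fun h => hp (hQu g' hg' h))⟩
    have hcc : (c.erase p).card = d + 1 := by
      rw [Finset.card_erase_of_mem hpc, hL.cardC c (hDC hc)]; rfl
    have := union_eq_of_subset (hcF g hg) (hcF g' hg') hcc hgg'.symm
      (Finset.subset_union_left.trans hsubc) (Finset.subset_union_right.trans hsubc)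
    exact hpair _ (this ▸ Finset.union_subset (hQu g hg) (hQu g' hg')) hcc g hg g' hg' hgg'
      (Finset.subset_union_left.trans hsubc) (Finset.subset_union_right.trans hsubc)
  let a' : Finset (Fin n) → K := fun f => if f = f₃ then 0 else a f
  have ha' : ∀ f, a' f ≠ 0 → f = f₁ ∨ f = f₂ := by
    intro f hf
    by_cases h : f = f₃
    · simp [a', h] at hf
    · simp only [a', if_neg h] at hf
      rcases ha f hf with h' | h' | h'
      · exact Or.inl h'
      · exact Or.inr h'
      · exact (h h').elim
  have h0 := hL.eq_zero z a' (fun f hf => by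
      rcases ha' f hf with rfl | rfl
      · exact ⟨hQF hf₁, hzf₁⟩
      · exact ⟨hQF hf₂, hzf₂⟩) (fun b hb hzb => by
      by_contra h0
      obtain ⟨f, hf, hfb⟩ := exists_subset_of_coboundary_ne_zero h0
      have hfQ : f ∈ Q := by
        rcases ha' f hf with rfl | rfl <;> assumption
      obtain ⟨p, hpb, hpf, hfe⟩ := exists_eq_erase hfb (by rw [hL.cardB b hb, hcF _ hfQ])
      have hbe : b = insert p f := by rw [hfe, Finset.insert_erase hpb]
      have hpu : p ∈ u := by
        by_contra hp
        exact houtside p hp f hfQ (hbe ▸ hb)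
      have hbu : b ⊆ u.erase z := Finset.subset_erase.2
        ⟨hbe ▸ Finset.insert_subset hpu (hQu f hfQ), hzb⟩
      rw [huz] at hbu
      have hbw := Finset.eq_of_subset_of_card_le hbu (by rw [hL.cardB b hb, hcw])
      refine h0 ?_
      rw [hbw, ← haw]
      refine coboundary_congr fun k _ => ?_
      simp only [a']
      rw [if_neg]
      intro h
      exact hsub (h ▸ Finset.erase_subset _ _))
  have := congrFun h0 f₁
  simp [a', a, h₁₃] at this

lemma LevelData.matchable_above (hL : LevelData K n d F B C) (Q : Finset (Finset (Fin n))) :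
    Q ⊆ F → Q.card ≤ 3 → ∀ D ⊆ C, ExactOn K B Q (above B Q) D →
      Matchable d Q (above B Q) D := by
  induction Q using Finset.strongInduction with
  | H Q ih =>
  intro hQF hQ3 D hDC hex
  have hsubB : ∀ Q' : Finset (Finset (Fin n)), above B Q' ⊆ B := fun _ => Finset.filter_subset _ _
  have hmono : ∀ Q' ⊆ Q, above B Q' ⊆ above B Q := by
    intro Q' h b hb
    obtain ⟨h1, f, hf, h2⟩ := mem_above.1 hb
    exact mem_above.2 ⟨h1, f, h hf, h2⟩
  have hcard : ∀ f ∈ Q, (Q.erase f).card ≤ 3 := fun f hf =>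
    (Finset.card_le_card (Finset.erase_subset _ _)).trans hQ3
  by_cases hiso : ∃ f ∈ Q, ∀ f' ∈ Q, f' ≠ f → ∀ b ∈ B, f ⊆ b → ¬ f' ⊆ b
  · obtain ⟨f, hf, hfiso⟩ := hiso
    have hQe : {f} ∪ Q.erase f = Q := by
      rw [← Finset.insert_eq, Finset.insert_erase hf]
    have hRe : above B {f} ∪ above B (Q.erase f) = above B Q := by
      conv_rhs => rw [← hQe]
      ext b
      simp only [Finset.mem_union, mem_above]
      grind
    have hdR : Disjoint (above B {f}) (above B (Q.erase f)) := by
      rw [Finset.disjoint_left]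
      intro b hb hb'
      obtain ⟨h1, g, hg, h2⟩ := mem_above.1 hb
      obtain ⟨-, g', hg', h3⟩ := mem_above.1 hb'
      rw [Finset.mem_singleton] at hg
      subst hg
      exact hfiso g' (Finset.mem_of_mem_erase hg') (Finset.ne_of_mem_erase hg') b h1 h2 h3
    have hfF : {f} ⊆ F := by simpa using hQF hf
    have heF : Q.erase f ⊆ F := (Finset.erase_subset _ _).trans hQF
    obtain ⟨D₁, D₂, h1, h2, h3, h4, h5⟩ := hL.exactOn_split (Q₁ := {f}) (Q₂ := Q.erase f) hDC hfF
      heF (hsubB _) (hsubB _) hdR subset_rfl subset_rfl (by rwa [hQe, hRe])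
    have := (hL.matchable_singleton (hQF hf) (h1.trans hDC) h4).union
      (ih _ (Finset.erase_ssubset hf) heF (hcard f hf) D₂ (h2.trans hDC) h5)
      (by simp) hdR h3 h1 h2
    rwa [hQe, hRe] at this
  by_cases hpriv : ∃ c ∈ D, ∃ f ∈ Q, f ⊆ c ∧ ∀ f' ∈ Q, f' ⊆ c → f' = f
  · obtain ⟨c, hc, f, hf, hfc, huniq⟩ := hpriv
    refine hL.matchable_insert hQF hf hDC hc hfc ?_
    have heF : Q.erase f ⊆ F := (Finset.erase_subset _ _).trans hQF
    have hsub : above B (Q.erase f) ⊆ above B Q \ between B f c := by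
      intro b hb
      refine Finset.mem_sdiff.2 ⟨hmono _ (Finset.erase_subset _ _) hb, fun h => ?_⟩
      obtain ⟨-, f', hf', h1⟩ := mem_above.1 hb
      exact Finset.ne_of_mem_erase hf' (huniq f' (Finset.mem_of_mem_erase hf')
        (h1.trans (mem_between.1 h).2.2))
    have hB' : above B Q \ between B f c ⊆ B := Finset.sdiff_subset.trans (hsubB _)
    have hex' := hL.exactOn_erase hQF hDC hex hf hc hfc huniq
    have hDC' : D.erase c ⊆ C := (Finset.erase_subset _ _).trans hDC
    obtain ⟨D₁, D₂, h1, h2, h3, h4, h5⟩ := hL.exactOn_split (Q₁ := Q.erase f) (Q₂ := ∅)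
      (R₁ := above B (Q.erase f)) (R₂ := (above B Q \ between B f c) \ above B (Q.erase f))
      hDC' heF (by simp) (hsubB _) (Finset.sdiff_subset.trans hB') Finset.disjoint_sdiff
      subset_rfl (by simp [above])
      (by rwa [Finset.union_empty, Finset.union_sdiff_of_subset hsub])
    have := (ih _ (Finset.erase_ssubset hf) heF (hcard f hf) D₁ (h1.trans hDC') h4).union
      (h5.matchable (d := d) (Finset.sdiff_subset.trans hB')) (by simp)
      Finset.disjoint_sdiff h3 h1 h2
    rwa [Finset.union_empty, Finset.union_sdiff_of_subset hsub] at this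
  push Not at hiso hpriv
  rcases Q.eq_empty_or_nonempty with rfl | ⟨g, hg⟩
  · exact hex.matchable (hsubB _)
  exfalso
  have hD : ∀ c ∈ D, ∀ f ∈ Q, f ⊆ c → ∃ f' ∈ Q, f' ≠ f ∧ f' ⊆ c := by
    intro c hc f hf hfc
    obtain ⟨f', h1, h2, h3⟩ := hpriv c hc f hf hfc
    exact ⟨f', h1, h3, h2⟩
  have hadj : ∀ f ∈ Q, ∃ f' ∈ Q, f' ≠ f ∧ f ∪ f' ∈ B := by
    intro f hf
    obtain ⟨f', hf', hne, b, hb, h1, h2⟩ := hiso f hf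
    refine ⟨f', hf', hne, ?_⟩
    rwa [union_eq_of_subset (hL.cardF f (hQF hf)) (hL.cardF f' (hQF hf')) (hL.cardB b hb) hne.symm
      h1 h2]
  have hcenter : ∃ f₁ ∈ Q, ∀ f ∈ Q, f ≠ f₁ → f₁ ∪ f ∈ B := by
    obtain ⟨g', hg', hne, hgg'⟩ := hadj g hg
    by_cases hall : ∀ f ∈ Q, f = g ∨ f = g'
    · refine ⟨g, hg, fun f hf hfg => ?_⟩
      rw [(hall f hf).resolve_left hfg]; exact hgg'
    push Not at hall
    obtain ⟨g'', hg'', h1, h2⟩ := hall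
    have hQe : ({g, g', g''} : Finset (Finset (Fin n))) = Q := by
      refine Finset.eq_of_subset_of_card_le ?_ ?_
      · intro i hi
        simp only [Finset.mem_insert, Finset.mem_singleton] at hi
        rcases hi with rfl | rfl | rfl <;> assumption
      · rw [Finset.card_eq_three.2 ⟨g, g', g'', hne.symm, h1.symm, h2.symm, rfl⟩]
        exact hQ3
    obtain ⟨k, hk, hkne, hkB⟩ := hadj g'' hg''
    rw [← hQe] at hk
    simp only [Finset.mem_insert, Finset.mem_singleton] at hk
    rcases hk with rfl | rfl | rfl
    · refine ⟨k, hg, fun f hf hfg => ?_⟩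
      rw [← hQe] at hf
      simp only [Finset.mem_insert, Finset.mem_singleton] at hf
      rcases hf with rfl | rfl | rfl
      · exact (hfg rfl).elim
      · exact hgg'
      · rw [Finset.union_comm]; exact hkB
    · refine ⟨k, hg', fun f hf hfg => ?_⟩
      rw [← hQe] at hf
      simp only [Finset.mem_insert, Finset.mem_singleton] at hf
      rcases hf with rfl | rfl | rfl
      · rw [Finset.union_comm]; exact hgg'
      · exact (hfg rfl).elim
      · rw [Finset.union_comm]; exact hkB
    · exact (hkne rfl).elim
  obtain ⟨f₁, hf₁, hstar⟩ := hcenter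
  obtain ⟨f₂, hf₂, hne, hw⟩ := hadj f₁ hf₁
  by_cases hsub : ∀ f ∈ Q, f ⊆ f₁ ∪ f₂
  · exact hL.false_of_subset_union hQF hDC hex hD hf₁ hf₂ hne.symm hw hsub
  push Not at hsub
  obtain ⟨f₃, hf₃, hf₃w⟩ := hsub
  have h₁₃ : f₁ ≠ f₃ := fun h => hf₃w (h ▸ Finset.subset_union_left)
  have h₂₃ : f₂ ≠ f₃ := fun h => hf₃w (h ▸ Finset.subset_union_right)
  have hQe : ({f₁, f₂, f₃} : Finset (Finset (Fin n))) = Q := by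
    refine Finset.eq_of_subset_of_card_le ?_ ?_
    · intro i hi
      simp only [Finset.mem_insert, Finset.mem_singleton] at hi
      rcases hi with rfl | rfl | rfl <;> assumption
    · rw [Finset.card_eq_three.2 ⟨f₁, f₂, f₃, hne.symm, h₁₃, h₂₃, rfl⟩]
      exact hQ3
  exact hL.false_of_triple hQF hDC hex hD (f₁ := f₁) (f₂ := f₂) (f₃ := f₃)
    (fun f => by rw [← hQe]; simp) hne.symm h₁₃ hw (hstar f₃ hf₃ h₁₃.symm) hf₃w

/-- With at most three faces of degree `d`, exactness yields disjoint intervals with tops in `C`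
covering all faces of degree `d` and `d + 1`. -/
theorem LevelData.matchable (hL : LevelData K n d F B C) (hF : F.card ≤ 3)
    (hex : ExactOn K B F B C) : Matchable d F B C := by
  have hsub : above B F ⊆ B := Finset.filter_subset _ _
  obtain ⟨D₁, D₂, h1, h2, h3, h4, h5⟩ := hL.exactOn_split (Q₁ := F) (Q₂ := ∅)
    (R₁ := above B F) (R₂ := B \ above B F) subset_rfl subset_rfl (by simp) hsub
    Finset.sdiff_subset Finset.disjoint_sdiff subset_rfl (by simp [above])
    (by rwa [Finset.union_empty, Finset.union_sdiff_of_subset hsub])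
  have := (hL.matchable_above F subset_rfl hF D₁ h1 h4).union
    (h5.matchable (d := d) Finset.sdiff_subset) (by simp) Finset.disjoint_sdiff h3 h1 h2
  rwa [Finset.union_empty, Finset.union_sdiff_of_subset hsub] at this

end Induction

section Partition

variable {K : Type*} [Field K] {n d : ℕ} {I J : Ideal (MvPolynomial (Fin n) K)}
  {F B C : Finset (Finset (Fin n))}

lemma Matchable.subset_of_eq (hF : ∀ f ∈ F, f.card = d) (hC : ∀ c ∈ C, c.card = d + 2)
    {g h : Finset (Fin n) → Finset (Fin n)}
    (h₂ : ∀ f ∈ F, h f ∈ C ∧ f ⊆ h f ∧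
      ∀ b : Finset (Fin n), b.card = d + 1 → f ⊆ b → b ⊆ h f → b ∈ B ∧ g b = h f)
    (h₃ : ∀ f ∈ F, ∀ f' ∈ F, h f = h f' → f = f')
    (h₄ : ∀ b ∈ B, ∀ b' ∈ B, g b = g b' → b = b' ∨ ∃ f ∈ F, f ⊆ b ∧ f ⊆ b' ∧ h f = g b)
    {b f : Finset (Fin n)} (hb : b ∈ B) (hf : f ∈ F) (e : h f = g b) : f ⊆ b := by
  obtain ⟨k1, k2, k3⟩ := h₂ f hf
  obtain ⟨b₀, hfb, hbh, hcb⟩ := Finset.exists_subsuperset_card_eq k2 (n := d + 1)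
    (by rw [hF f hf]; omega) (by rw [hC _ k1]; omega)
  obtain ⟨k4, k5⟩ := k3 b₀ hcb hfb hbh
  rcases h₄ b₀ k4 b hb (k5.trans e) with rfl | ⟨f', hf', -, h2, h3⟩
  · exact hfb
  · rwa [h₃ f' hf' f hf (h3.trans k5)] at h2

lemma Matchable.exists_partition (hm : Matchable d F B C) (hlow : ∀ T ∈ sqPoset I J, d ≤ T.card)
    (hF : ∀ T, T ∈ F ↔ T ∈ degSet I J d) (hB : ∀ T, T ∈ B ↔ T ∈ degSet I J (d + 1))
    (hC : ∀ T, T ∈ C ↔ T ∈ degSet I J (d + 2)) :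
    ∃ P, IsIntervalPartition I J P ∧ ∀ p ∈ P, d + 2 ≤ p.2.card := by
  classical
  obtain ⟨g, h, h₁, h₂, h₃, h₄⟩ := hm
  have hcF : ∀ f ∈ F, f.card = d := fun f hf => ((hF f).1 hf).2
  have hcB : ∀ f ∈ B, f.card = d + 1 := fun f hf => ((hB f).1 hf).2
  have hcC : ∀ f ∈ C, f.card = d + 2 := fun f hf => ((hC f).1 hf).2
  have hsub : ∀ b ∈ B, ∀ f ∈ F, h f = g b → f ⊆ b := fun b hb f hf e =>
    Matchable.subset_of_eq hcF hcC h₂ h₃ h₄ hb hf e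
  refine ⟨Finset.univ.filter fun p => (p.1 ∈ F ∧ p.2 = h p.1) ∨
    (p.1 ∈ B ∧ p.2 = g p.1 ∧ ∀ f ∈ F, h f ≠ g p.1) ∨
    (p.1 ∈ sqPoset I J ∧ d + 2 ≤ p.1.card ∧ p.2 = p.1 ∧ (∀ f ∈ F, h f ≠ p.1) ∧
      ∀ b ∈ B, g b ≠ p.1), ⟨?_, ?_⟩, ?_⟩
  · rintro ⟨u, v⟩ hp
    rw [Finset.mem_filter] at hp
    rcases hp.2 with ⟨k1, k2⟩ | ⟨k1, k2, k3⟩ | ⟨k1, k2, k3, -⟩ <;> dsimp only at *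
    · subst k2
      exact ⟨((hF u).1 k1).1, ((hC _).1 (h₂ u k1).1).1, (h₂ u k1).2.1⟩
    · subst k2
      exact ⟨((hB u).1 k1).1, ((hC _).1 (h₁ u k1).1).1, (h₁ u k1).2⟩
    · subst k3
      exact ⟨k1, k1, subset_rfl⟩
  · intro T hT
    have hge := hlow T hT
    have hcov : ∀ u v : Finset (Fin n), u ∈ F → v = h u → u ⊆ T → T ⊆ v →
        T.card = d ∧ u = T ∨ T.card = d + 1 ∧ T ∈ B ∧ g T = v ∨ T.card = d + 2 ∧ T = v := by
      rintro u v hu rfl h1 h2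
      obtain ⟨k1, k2, k3⟩ := h₂ u hu
      have c1 := Finset.card_le_card h1
      have c2 := Finset.card_le_card h2
      rw [hcC _ k1] at c2
      rw [hcF _ hu] at c1
      have : T.card = d ∨ T.card = d + 1 ∨ T.card = d + 2 := by omega
      rcases this with e | e | e
      · exact Or.inl ⟨e, Finset.eq_of_subset_of_card_le h1 (by rw [e, hcF _ hu])⟩
      · exact Or.inr (Or.inl ⟨e, k3 T e h1 h2⟩)
      · exact Or.inr (Or.inr ⟨e, Finset.eq_of_subset_of_card_le h2 (by rw [e, hcC _ k1])⟩)
    have hcov' : ∀ u v : Finset (Fin n), u ∈ B → v = g u → u ⊆ T → T ⊆ v →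
        T.card = d + 1 ∧ u = T ∨ T.card = d + 2 ∧ T = v := by
      rintro u v hu rfl h1 h2
      obtain ⟨k1, k2⟩ := h₁ u hu
      have c1 := Finset.card_le_card h1
      have c2 := Finset.card_le_card h2
      rw [hcC _ k1] at c2
      rw [hcB _ hu] at c1
      have : T.card = d + 1 ∨ T.card = d + 2 := by omega
      rcases this with e | e
      · exact Or.inl ⟨e, Finset.eq_of_subset_of_card_le h1 (by rw [e, hcB _ hu])⟩
      · exact Or.inr ⟨e, Finset.eq_of_subset_of_card_le h2 (by rw [e, hcC _ k1])⟩
    simp only [Finset.mem_filter, Finset.mem_univ, true_and]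
    rcases (by omega : T.card = d ∨ T.card = d + 1 ∨ d + 2 ≤ T.card) with e | e | e
    · have hTF : T ∈ F := (hF T).2 ⟨hT, e⟩
      refine ⟨(T, h T), ⟨Or.inl ⟨hTF, rfl⟩, subset_rfl, (h₂ T hTF).2.1⟩, ?_⟩
      rintro ⟨u, v⟩ ⟨⟨k1, k2⟩ | ⟨k1, k2, k3⟩ | ⟨k1, k2, k3, -⟩, k4, k5⟩ <;> dsimp only at *
      · rcases hcov u v k1 k2 k4 k5 with ⟨-, rfl⟩ | ⟨x, -⟩ | ⟨x, -⟩
        · rw [k2]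
        · omega
        · omega
      · rcases hcov' u v k1 k2 k4 k5 with ⟨x, -⟩ | ⟨x, -⟩ <;> omega
      · have := Finset.card_le_card k4
        omega
    · have hTB : T ∈ B := (hB T).2 ⟨hT, e⟩
      by_cases hex : ∃ f ∈ F, h f = g T
      · obtain ⟨f, hf, hfT⟩ := hex
        refine ⟨(f, h f), ⟨Or.inl ⟨hf, rfl⟩, hsub T hTB f hf hfT, hfT ▸ (h₁ T hTB).2⟩, ?_⟩
        rintro ⟨u, v⟩ ⟨⟨k1, k2⟩ | ⟨k1, k2, k3⟩ | ⟨k1, k2, k3, -⟩, k4, k5⟩ <;> dsimp only at *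
        · rcases hcov u v k1 k2 k4 k5 with ⟨x, -⟩ | ⟨-, -, x⟩ | ⟨x, -⟩
          · omega
          · have : u = f := h₃ u k1 f hf (by rw [hfT, x, k2])
            rw [k2, this]
          · omega
        · rcases hcov' u v k1 k2 k4 k5 with ⟨-, rfl⟩ | ⟨x, -⟩
          · exact (k3 f hf hfT).elim
          · omega
        · have := Finset.card_le_card k4
          omega
      · push Not at hex
        refine ⟨(T, g T), ⟨Or.inr (Or.inl ⟨hTB, rfl, hex⟩), subset_rfl, (h₁ T hTB).2⟩, ?_⟩
        rintro ⟨u, v⟩ ⟨⟨k1, k2⟩ | ⟨k1, k2, k3⟩ | ⟨k1, k2, k3, -⟩, k4, k5⟩ <;> dsimp only at *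
        · rcases hcov u v k1 k2 k4 k5 with ⟨x, -⟩ | ⟨-, -, x⟩ | ⟨x, -⟩
          · omega
          · exact (hex u k1 (by rw [x, k2])).elim
          · omega
        · rcases hcov' u v k1 k2 k4 k5 with ⟨-, rfl⟩ | ⟨x, -⟩
          · rw [k2]
          · omega
        · have := Finset.card_le_card k4
          omega
    · by_cases hex : ∃ f ∈ F, h f = T
      · obtain ⟨f, hf, rfl⟩ := hex
        refine ⟨(f, h f), ⟨Or.inl ⟨hf, rfl⟩, (h₂ f hf).2.1, subset_rfl⟩, ?_⟩
        rintro ⟨u, v⟩ ⟨⟨k1, k2⟩ | ⟨k1, k2, k3⟩ | ⟨k1, k2, k3, k6, -⟩, k4, k5⟩ <;> dsimp only at *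
        · rcases hcov u v k1 k2 k4 k5 with ⟨x, -⟩ | ⟨x, -⟩ | ⟨-, x⟩
          · omega
          · omega
          · rw [← x, h₃ f hf u k1 (x.trans k2)]
        · rcases hcov' u v k1 k2 k4 k5 with ⟨x, -⟩ | ⟨-, x⟩
          · omega
          · exact (k3 f hf (x.trans k2)).elim
        · exact (k6 f hf (Finset.Subset.antisymm (k3 ▸ k5) k4)).elim
      · push Not at hex
        by_cases hexb : ∃ b ∈ B, g b = T
        · obtain ⟨b, hb, rfl⟩ := hexb
          refine ⟨(b, g b), ⟨Or.inr (Or.inl ⟨hb, rfl, hex⟩), (h₁ b hb).2, subset_rfl⟩, ?_⟩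
          rintro ⟨u, v⟩ ⟨⟨k1, k2⟩ | ⟨k1, k2, k3⟩ | ⟨k1, k2, k3, -, k6⟩, k4, k5⟩ <;> dsimp only at *
          · rcases hcov u v k1 k2 k4 k5 with ⟨x, -⟩ | ⟨x, -⟩ | ⟨-, x⟩
            · omega
            · omega
            · exact (hex u k1 (x.trans k2).symm).elim
          · rcases hcov' u v k1 k2 k4 k5 with ⟨x, -⟩ | ⟨-, x⟩
            · omega
            · rcases h₄ b hb u k1 (x.trans k2) with rfl | ⟨f, hf, -, -, y⟩
              · rw [k2]
              · exact (hex f hf y).elim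
          · exact (k6 b hb (Finset.Subset.antisymm (k3 ▸ k5) k4)).elim
        · push Not at hexb
          refine ⟨(T, T), ⟨Or.inr (Or.inr ⟨hT, e, rfl, hex, hexb⟩), subset_rfl, subset_rfl⟩, ?_⟩
          rintro ⟨u, v⟩ ⟨⟨k1, k2⟩ | ⟨k1, k2, k3⟩ | ⟨k1, k2, k3, -⟩, k4, k5⟩ <;> dsimp only at *
          · rcases hcov u v k1 k2 k4 k5 with ⟨x, -⟩ | ⟨x, -⟩ | ⟨-, x⟩
            · omega
            · omega
            · exact (hex u k1 (x.trans k2).symm).elim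
          · rcases hcov' u v k1 k2 k4 k5 with ⟨x, -⟩ | ⟨-, x⟩
            · omega
            · exact (hexb u k1 (x.trans k2).symm).elim
          · have : u = T := Finset.Subset.antisymm k4 (k3 ▸ k5)
            rw [k3, this]
  · rintro ⟨u, v⟩ hp
    rw [Finset.mem_filter] at hp
    rcases hp.2 with ⟨k1, k2⟩ | ⟨k1, k2, k3⟩ | ⟨k1, k2, k3, -⟩ <;> dsimp only at *
    · rw [k2, hcC _ (h₂ u k1).1]
    · rw [k2, hcC _ (h₁ u k1).1]
    · rwa [k3]

lemma bddAbove_sdepth {T : Finset (Fin n)} (hT : T ∈ sqPoset I J) :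
    ∀ k ∈ {k | ∃ P, IsIntervalPartition I J P ∧ ∀ p ∈ P, k ≤ p.2.card}, k ≤ n := by
  rintro k ⟨P, hP, hk⟩
  obtain ⟨p, ⟨hp, -⟩, -⟩ := hP.2 T hT
  exact (hk p hp).trans (by simpa using Finset.card_le_univ p.2)

end Partition

/-- If `I` is minimally generated by `r ≤ 3` squarefree monomials of
degree `d` together with a set `E` of squarefree monomials of degrees `≥ d+1`,
`J` is `0` or generated by squarefree monomials of degrees `≥ d+1`, and
`sdepth I/J = d+1`, then `depth I/J ≤ d+1`. -/
theorem statement0 {K : Type*} [Field K] {n : ℕ} (d : ℕ) (hd : 0 < d)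
    (r : ℕ) (hr0 : 0 < r) (hr : r ≤ 3)
    (I J : Ideal (MvPolynomial (Fin n) K)) (hJI : J < I)
    (f : Fin r → Finset (Fin n)) (hfinj : Function.Injective f)
    (hfd : ∀ i, (f i).card = d)
    (E : Set (Finset (Fin n))) (hE : ∀ T ∈ E, d + 1 ≤ T.card)
    (hI : I = Ideal.span (sqm K '' (Set.range f ∪ E)))
    (hmin : ∀ g ∈ Set.range f ∪ E,
      sqm K g ∉ Ideal.span (sqm K '' ((Set.range f ∪ E) \ {g})))
    (hJ : SqfreeGenFrom J (d + 1))
    (hsd : sdepth I J = d + 1) :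
    depthIJ I J ≤ d + 1 := by
  classical
  by_contra hdepth
  rw [not_le] at hdepth
  obtain ⟨H, hH, rfl⟩ := hJ
  set J := Ideal.span (sqm K '' H) with hJdef
  have hv : KoszulVanish I J (d + 1) := koszulVanish_of_lt_depthIJ hdepth
  have hG : ∀ g ∈ Set.range f ∪ E, d ≤ g.card := by
    rintro g (⟨i, rfl⟩ | hg)
    · exact (hfd i).ge
    · exact (Nat.le_succ d).trans (hE g hg)
  have hlow : ∀ T ∈ sqPoset I J, d ≤ T.card := by
    rintro T ⟨hT, -⟩
    rw [hI, sqm_mem_span_iff] at hT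
    obtain ⟨g, hg, hgT⟩ := hT
    exact (hG g hg).trans (Finset.card_le_card hgT)
  have hfP : ∀ i, f i ∈ degSet I J d := by
    refine fun i => ⟨⟨?_, fun h => ?_⟩, hfd i⟩
    · rw [hI]
      exact Ideal.subset_span ⟨f i, Or.inl ⟨i, rfl⟩, rfl⟩
    · obtain ⟨g, hg, hgf⟩ := sqm_mem_span_iff.1 h
      have h1 := hH g hg
      have h2 := Finset.card_le_card hgf
      rw [hfd i] at h2
      omega
  have hbdd := bddAbove_sdepth (hfP ⟨0, hr0⟩).1
  have hdn : d < n := by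
    refine lt_of_lt_of_le (Nat.lt_succ_self d) (hbdd (d + 1) ?_)
    rw [← hsd]
    refine Nat.sSup_mem ?_ ⟨n, hbdd⟩
    by_contra hne
    rw [Set.not_nonempty_iff_eq_empty] at hne
    rw [sdepth, hne] at hsd
    simp at hsd
  let L : ℕ → Finset (Finset (Fin n)) := fun k => Finset.univ.filter (· ∈ degSet I J k)
  have hL : ∀ k T, T ∈ L k ↔ T ∈ degSet I J k := fun k T => by simp [L]
  have hdata : LevelData K n d (L d) (L (d + 1)) (L (d + 2)) := by
    refine ⟨hdn, fun T hT => ((hL _ _).1 hT).2, fun T hT => ((hL _ _).1 hT).2,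
      fun T hT => ((hL _ _).1 hT).2, fun c hc b hbc hb g hg hgb => ?_, fun j a ha hz => ?_⟩
    · rw [hL] at hc hg ⊢
      exact ⟨mem_sqPoset_of_subset hg.1 hgb fun h => hc.1.2 (sqm_mem_of_subset h hbc), hb⟩
    · refine eq_zero_of_koszulVanish hI hJdef hG hv j a (fun T hT => ?_) fun b hb hjb => ?_
      · exact ⟨(hL _ _).1 (ha T hT).1, (ha T hT).2⟩
      · exact hz b ((hL _ _).2 hb) hjb
  have hcard : (L d).card ≤ 3 := by
    have hsub : L d ⊆ Finset.univ.image f := by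
      intro T hT
      obtain ⟨⟨hTI, -⟩, hTd⟩ := (hL _ _).1 hT
      rw [hI, sqm_mem_span_iff] at hTI
      obtain ⟨g, hg | hg, hgT⟩ := hTI
      · obtain ⟨i, rfl⟩ := hg
        have := Finset.eq_of_subset_of_card_le hgT (by rw [hTd, hfd i])
        exact Finset.mem_image.2 ⟨i, Finset.mem_univ i, this⟩
      · have h1 := hE g hg
        have h2 := Finset.card_le_card hgT
        omega
    exact (Finset.card_le_card hsub).trans (Finset.card_image_le.trans (by simpa using hr))
  have hex : ExactOn K (L (d + 1)) (L d) (L (d + 1)) (L (d + 2)) := by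
    intro l hl hz
    obtain ⟨a, ha, hla⟩ := exists_coboundary_eq_of_koszulVanish hI hJdef hG hv l
      (fun b hb => (hL _ _).1 (hl b hb)) fun c hc => hz c ((hL _ _).2 hc)
    refine ⟨a, fun T hT => ?_, fun b hb => hla b ((hL _ _).1 hb)⟩
    obtain ⟨hg | hg, hc⟩ := ha T hT
    · obtain ⟨i, rfl⟩ := hg
      exact (hL _ _).2 (hfP i)
    · have := hE T hg
      omega
  obtain ⟨P, hP, hPd⟩ := (hdata.matchable hcard hex).exists_partition hlow (hL _) (hL _) (hL _)
  have : d + 2 ≤ sdepth I J := le_csSup ⟨n, hbdd⟩ ⟨P, hP, hPd⟩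
  omega
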